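/- If M ≤ N, then the rescaled coarse-grained processes 2^{-M} Q_M X_N and 2^{-M} Q_M X'_N have distributions P_{N-M} and P'_{N-M} respectively; that is, Q_M X_N and Q_M X'_N are simple random walks on the coarse graph F_M conditioned and stopped at a_N in the corresponding way. -/

import Mathlib

/-!  Loop-erased random walks on the pre-Sierpinski gasket
     (K. Hattori - M. Mizuno, "Loop-erased random walk on the Sierpinski gasket").

     Common definitions: the pre-Sierpinski gasket, finite random-walk paths,
     hitting times, coarse graining, skeletons, the larger-scale-loops-first
     loop-erasing procedure, the associated generating functions, and the
     scaled (continuum) setting on the finite Sierpinski gasket. -/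

open scoped Classical NNReal ENNReal Topology
open MeasureTheory Filter Set

noncomputable section

namespace LERW

/-! ### The pre-Sierpinski gasket -/

/-- Points of the plane. -/
abbrev Pt : Type := ℝ × ℝ

/-- The origin `O`. -/
def ptO : Pt := (0, 0)

/-- `a_N = 2^N (1/2, √3/2)`. -/
def ptA (N : ℕ) : Pt := ((2:ℝ)^N * (1/2), (2:ℝ)^N * (Real.sqrt 3 / 2))

/-- `b_N = 2^N (1, 0)`. -/
def ptB (N : ℕ) : Pt := ((2:ℝ)^N, 0)

/-- Vertices of the graph `F'_N`. -/
def preVerts : ℕ → Set Pt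
  | 0 => {ptO, ptA 0, ptB 0}
  | N+1 => preVerts N ∪ ((· + ptA N) '' preVerts N) ∪ ((· + ptB N) '' preVerts N)

/-- Edges of the graph `F'_N` (as a symmetric set of ordered pairs). -/
def preEdges : ℕ → Set (Pt × Pt)
  | 0 => {(ptO, ptA 0), (ptA 0, ptO), (ptO, ptB 0), (ptB 0, ptO), (ptA 0, ptB 0), (ptB 0, ptA 0)}
  | N+1 => preEdges N ∪ ((fun e => (e.1 + ptA N, e.2 + ptA N)) '' preEdges N)
      ∪ ((fun e => (e.1 + ptB N, e.2 + ptB N)) '' preEdges N)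

/-- Reflection with respect to the `y`-axis. -/
def reflY (p : Pt) : Pt := (-p.1, p.2)

/-- `G_0`: the vertex set of the infinite pre-Sierpinski gasket `F_0`. -/
def G0 : Set Pt := ⋃ N, (preVerts N ∪ reflY '' preVerts N)

/-- `E_0`: the edge set of the infinite pre-Sierpinski gasket `F_0`. -/
def E0 : Set (Pt × Pt) := ⋃ N, (preEdges N ∪ (fun e => (reflY e.1, reflY e.2)) '' preEdges N)

/-- `G_M = 2^M G_0`: the vertex set of the coarse graph `F_M`. -/
def G (M : ℕ) : Set Pt := (fun p : Pt => ((2:ℝ)^M) • p) '' G0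

/-! ### Finite paths on the pre-Sierpinski gasket -/

/-- A finite path `(w(0), w(1), …, w(len))`, recorded as a function `ℕ → Pt`
which is (by convention) frozen at its final value after time `len`. -/
structure Path where
  X : ℕ → Pt
  len : ℕ

/-- `w` is a finite nearest-neighbour walk on `F_0` starting at `O`,
stopped at time `w.len`. -/
def IsWalk (w : Path) : Prop :=
  w.X 0 = ptO ∧ (∀ i, i ≤ w.len → w.X i ∈ G0) ∧
    (∀ i, i < w.len → (w.X i, w.X (i+1)) ∈ E0) ∧ (∀ i, w.len ≤ i → w.X i = w.X w.len)

/-- `hitT M w i = T_i^M(w)`, the successive hitting times of `G_M`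
(hitting the same vertex several times in a row is counted once). -/
def hitT (M : ℕ) (w : Path) : ℕ → ℕ
  | 0 => sInf {j | w.X j ∈ G M}
  | i+1 => sInf {j | hitT M w i < j ∧ w.X j ∈ G M ∧ w.X j ≠ w.X (hitT M w i)}

/-- `W_N`: finite walks from `O` to `a_N` which hit no other vertex of `G_N` on the way. -/
def WSet (N : ℕ) : Set Path :=
  {w | IsWalk w ∧ w.X w.len = ptA N ∧ w.len = hitT N w 1}

/-- `V_N`: finite walks from `O` to `a_N` hitting `b_N` (once) on the way. -/
def VSet (N : ℕ) : Set Path :=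
  {w | IsWalk w ∧ w.X (hitT N w 1) = ptB N ∧ w.X w.len = ptA N ∧ w.len = hitT N w 2}

/-- Probability of the cylinder of a simple-random-walk path (`(1/4)^length`). -/
def rwWeight (w : Path) : ℝ := (1/4 : ℝ) ^ w.len

/-- `P_N[w] = (1/4)^{ℓ(w)} / (1/4)`: mass of `w ∈ W_N` under the conditioned walk `X_N`. -/
def PW (w : Path) : ℝ := 4 * (1/4 : ℝ) ^ w.len

/-- `P'_N[w] = (1/4)^{ℓ(w)} / (1/16)`: mass of `w ∈ V_N` under the conditioned walk `X'_N`. -/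
def PV (w : Path) : ℝ := 16 * (1/4 : ℝ) ^ w.len

/-- Self-avoiding paths. -/
def SelfAvoiding (w : Path) : Prop :=
  ∀ i j, i ≤ w.len → j ≤ w.len → w.X i = w.X j → i = j

/-- `Ŵ_N`: the self-avoiding elements of `W_N`. -/
def WHat (N : ℕ) : Set Path := {w | w ∈ WSet N ∧ SelfAvoiding w}

/-- `V̂_N`: the self-avoiding elements of `V_N`. -/
def VHat (N : ℕ) : Set Path := {w | w ∈ VSet N ∧ SelfAvoiding w}

/-- Spatial rescaling of a path by a factor `c`. -/
def scalePath (c : ℝ) (w : Path) : Path := ⟨fun i => c • w.X i, w.len⟩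

/-! ### Coarse graining -/

/-- The number of coarse steps of `w` at scale `2^M`. -/
def coarseLen (M : ℕ) (w : Path) : ℕ := sInf {i | hitT M w i = w.len}

/-- `Q_M w`: the coarse-grained path `(w(T_0^M), w(T_1^M), …)` on the graph `F_M`. -/
def coarse (M : ℕ) (w : Path) : Path :=
  ⟨fun i => w.X (hitT M w (min i (coarseLen M w))), coarseLen M w⟩

/-! ### `2^M`-triangles and skeletons -/

/-- The vertices of the upward `2^M`-triangle with base point `z`. -/
def triVerts (M : ℕ) (z : Pt) : Set Pt := {z, z + ptA M, z + ptB M}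

/-- The (closed, filled) upward `2^M`-triangle with base point `z`. -/
def triSet (M : ℕ) (z : Pt) : Set Pt := convexHull ℝ (triVerts M z)

/-- `z` is the base point of an upward `2^M`-triangle with vertices in `G_M`. -/
def IsTriBase (M : ℕ) (z : Pt) : Prop :=
  z ∈ G M ∧ z + ptA M ∈ G M ∧ z + ptB M ∈ G M

/-- The base point of the (unique) upward `2^M`-triangle having both `x` and `y`
among its vertices. -/
def triOf (M : ℕ) (x y : Pt) : Pt :=
  Classical.epsilon fun z => IsTriBase M z ∧ x ∈ triVerts M z ∧ y ∈ triVerts M z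

/-- `skel M w i = (T_i^{ex,M}(w), base point of Δ_{i+1})`: the exit times from, and the
base points of, the successive `2^M`-triangles of the skeleton `σ_M(w)`. -/
def skel (M : ℕ) (w : Path) : ℕ → ℕ × Pt
  | 0 => (hitT M w 0, triOf M (w.X (hitT M w 0)) (w.X (hitT M w 1)))
  | i+1 =>
    let e := (skel M w i).1
    let z := (skel M w i).2
    let jj := sInf {j | e < hitT M w j ∧ w.X (hitT M w (j+1)) ∉ triSet M z}
    (hitT M w jj, triOf M (w.X (hitT M w jj)) (w.X (hitT M w (jj+1))))

/-- `T_i^{ex,M}(w)`: exit time from the `i`-th triangle of the skeleton (`exitT M w 0 = T_0^M`). -/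
def exitT (M : ℕ) (w : Path) (i : ℕ) : ℕ := (skel M w i).1

/-- Base point of the triangle `Δ_{i+1}` of the skeleton `σ_M(w)` (`i = 0, 1, …`). -/
def triBase (M : ℕ) (w : Path) (i : ℕ) : Pt := (skel M w i).2

/-- The number `k` of triangles in the skeleton `σ_M(w)`. -/
def numTri (M : ℕ) (w : Path) : ℕ := sInf {k | exitT M w k = w.len}

/-- The index `n` with `T_n^M(w) = T_i^{ex,M}(w)` (entrance index of `Δ_{i+1}`). -/
def entIdx (M : ℕ) (w : Path) (i : ℕ) : ℕ := sInf {n | hitT M w n = exitT M w i}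

/-- The triangle `Δ_{i+1}` of `σ_M(w)` is of Type 1 (crossed in one `G_M`-hitting step). -/
def IsType1 (M : ℕ) (w : Path) (i : ℕ) : Prop :=
  exitT M w (i+1) = hitT M w (entIdx M w i + 1)

/-- The triangle `Δ_{i+1}` of `σ_M(w)` is of Type 2 (crossed in two `G_M`-hitting steps). -/
def IsType2 (M : ℕ) (w : Path) (i : ℕ) : Prop :=
  exitT M w (i+1) = hitT M w (entIdx M w i + 2)

/-- `s_1(w)` at scale `M`: the number of Type 1 triangles of `σ_M(w)`. -/
def s1 (M : ℕ) (w : Path) : ℕ :=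
  ((Finset.range (numTri M w)).filter fun i => IsType1 M w i).card

/-- `s_2(w)` at scale `M`: the number of Type 2 triangles of `σ_M(w)`. -/
def s2 (M : ℕ) (w : Path) : ℕ :=
  ((Finset.range (numTri M w)).filter fun i => IsType2 M w i).card

/-- Equality of the `2^K`-skeletons of two paths. -/
def SkelEq (K : ℕ) (u v : Path) : Prop :=
  numTri K u = numTri K v ∧ ∀ i, i < numTri K u → triBase K u i = triBase K v i

/-! ### The larger-scale-loops-first loop-erasing procedure -/

/-- Last-exit times `s_0, s_1, …` of the loop-erasing rule, applied to the coarse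
(scale `2^m`) path of `w` between the coarse indices `a` and `b`. -/
def lee (m : ℕ) (w : Path) (a b : ℕ) : ℕ → ℕ
  | 0 => sSup {j | a ≤ j ∧ j ≤ b ∧ w.X (hitT m w j) = w.X (hitT m w a)}
  | i+1 => sSup {j | a ≤ j ∧ j ≤ b ∧ w.X (hitT m w j) = w.X (hitT m w (lee m w a b i + 1))}

/-- The number of coarse steps of the loop-erased coarse path of the window `[a, b]`. -/
def leeLen (m : ℕ) (w : Path) (a b : ℕ) : ℕ := sInf {i | lee m w a b i = b}

/-- The retained segments of the original path `w` (between the coarse last-exit times of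
the window `[a, b]` at scale `2^m`), concatenated; the final point is omitted. -/
def windowList (m : ℕ) (w : Path) (a b : ℕ) : List Pt :=
  (((List.range (leeLen m w a b)).map fun i =>
    (List.range' (hitT m w (lee m w a b i))
      (hitT m w (lee m w a b i + 1) - hitT m w (lee m w a b i))).map w.X)).flatten

/-- The path determined by a (nonempty) list of points. -/
def ofList (l : List Pt) : Path :=
  ⟨fun i => l.getD (min i (l.length - 1)) ptO, l.length - 1⟩

/-- The coarse index (at scale `2^m`) of an original time `t`. -/
def idxOf (m : ℕ) (w : Path) (t : ℕ) : ℕ := sInf {j | hitT m w j = t}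

/-- One step of the loop-erasing procedure: erase all `2^m`-scale loops of `w`
(all larger-scale loops being already erased), by erasing, within each triangle
of the skeleton `σ_{m+1}(w)`, the loops of the scale-`2^m` coarse path by the
last-exit rule and concatenating the corresponding retained segments of `w`. -/
def eraseScale (m : ℕ) (w : Path) : Path :=
  ofList (((((List.range (numTri (m+1) w)).map fun i =>
      windowList m w (idxOf m w (exitT (m+1) w i)) (idxOf m w (exitT (m+1) w (i+1))))).flatten)
    ++ [w.X w.len])

/-- Erase the loops of the `t` largest scales `2^{N-1}, 2^{N-2}, …, 2^{N-t}`,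
larger scales first. -/
def eraseTop (N : ℕ) (w : Path) : ℕ → Path
  | 0 => w
  | t+1 => eraseScale (N - 1 - t) (eraseTop N w t)

/-- The loop erasure `L w` of a path `w ∈ W_N ∪ V_N`. -/
def loopErase (N : ℕ) (w : Path) : Path := eraseTop N w N

/-- The path obtained from `w ∈ W_N ∪ V_N` once all loops of scale `≥ 2^M` are erased. -/
def partialLE (N M : ℕ) (w : Path) : Path := eraseTop N w (N - M)

/-- `Q̂_M w`: the loop-free coarse path on `F_M` obtained from `w ∈ W_N ∪ V_N` once all
loops of scale `≥ 2^M` have been erased. -/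
def Qhat (N M : ℕ) (w : Path) : Path := coarse M (partialLE N M w)

/-! ### Generating functions and the mean matrix -/

/-- `Φ_N(x,y) = Σ_{w ∈ Ŵ_N} P̂_N(w) x^{s_1(w)} y^{s_2(w)}
             = E[x^{s_1(L X_N)} y^{s_2(L X_N)}]`. -/
def PhiN (N : ℕ) (x y : ℝ) : ℝ :=
  ∑' w : WSet N, PW w.1 * x ^ s1 0 (loopErase N w.1) * y ^ s2 0 (loopErase N w.1)

/-- `Θ_N(x,y) = Σ_{w ∈ V̂_N} P̂'_N(w) x^{s_1(w)} y^{s_2(w)}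
             = E[x^{s_1(L X'_N)} y^{s_2(L X'_N)}]`. -/
def ThetaN (N : ℕ) (x y : ℝ) : ℝ :=
  ∑' w : VSet N, PV w.1 * x ^ s1 0 (loopErase N w.1) * y ^ s2 0 (loopErase N w.1)

/-- The polynomial `Φ(x,y) = (15x² + 8xy + y² + 2x²y + 4x³)/30`. -/
def PhiPoly (x y : ℝ) : ℝ := (15*x^2 + 8*x*y + y^2 + 2*x^2*y + 4*x^3) / 30

/-- The polynomial `Θ(x,y) = (5x² + 11xy + 2y² + 14x²y + 8x³ + 5xy²)/45`. -/
def ThetaPoly (x y : ℝ) : ℝ := (5*x^2 + 11*x*y + 2*y^2 + 14*x^2*y + 8*x^3 + 5*x*y^2) / 45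

/-- The complexification of `Φ`. -/
def PhiPolyC (x y : ℂ) : ℂ := (15*x^2 + 8*x*y + y^2 + 2*x^2*y + 4*x^3) / 30

/-- The complexification of `Θ`. -/
def ThetaPolyC (x y : ℂ) : ℂ := (5*x^2 + 11*x*y + 2*y^2 + 14*x^2*y + 8*x^3 + 5*x*y^2) / 45

/-- The mean matrix `M = [[9/5, 2/15], [26/15, 13/15]]`. -/
def meanMat : Matrix (Fin 2) (Fin 2) ℝ := !![9/5, 2/15; 26/15, 13/15]

/-- `λ = (20 + √205)/15`, the largest eigenvalue of the mean matrix. -/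
def lamR : ℝ := (20 + Real.sqrt 205) / 15

/-- The law of `λ^{-N} ℓ(L X_N)` (as a measure on `ℝ`). -/
def lawLen (N : ℕ) : Measure ℝ :=
  Measure.sum fun w : WSet N =>
    ENNReal.ofReal (PW w.1) • Measure.dirac ((lamR ^ N)⁻¹ * ((loopErase N w.1).len : ℝ))

/-! ### Identification of path segments -/

/-- Euclidean distance in the plane. -/
def euclDist (p q : Pt) : ℝ := Real.sqrt ((p.1 - q.1)^2 + (p.2 - q.2)^2)

/-- `f` is a Euclidean isometry of the plane (a composition of a translation,
a rotation and possibly a reflection). -/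
def IsEuclIsom (f : Pt → Pt) : Prop := ∀ p q, euclDist (f p) (f q) = euclDist p q

/-- The walk segment of `w` between its `i`-th and `(i+1)`-st hitting times of `G_M`,
identified - via a plane isometry sending its entrance vertex to `O` and its exit vertex
to `a_K` - with the path `u`. -/
def SegMatch (K M : ℕ) (w : Path) (i : ℕ) (u : Path) : Prop :=
  ∃ η : Pt → Pt, IsEuclIsom η ∧ η (w.X (hitT M w i)) = ptO ∧
    η (w.X (hitT M w (i+1))) = ptA K ∧
    u.len = hitT M w (i+1) - hitT M w i ∧
    ∀ t, hitT M w i ≤ t → t ≤ hitT M w (i+1) → η (w.X t) = u.X (t - hitT M w i)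

/-- The traverse time of the `(i+1)`-st triangle of the skeleton `σ_M(u)`. -/
def travTime (M : ℕ) (u : Path) (i : ℕ) : ℕ := exitT M u (i+1) - exitT M u i

/-- The skeleton of `u` at scale `2^M` consists of `k` triangles with base points
`base 0, …, base (k-1)` and types `typ 0, …, typ (k-1)` (`true` = Type 1). -/
def SkelData (M : ℕ) (u : Path) (k : ℕ) (base : ℕ → Pt) (typ : ℕ → Bool) : Prop :=
  numTri M u = k ∧ ∀ i, i < k →
    triBase M u i = base i ∧ (if typ i then IsType1 M u i else IsType2 M u i)

/-! ### The scaled setting: paths on the finite Sierpinski gasket -/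

/-- Continuous-time paths in the plane (the ambient space of the path space `C`). -/
abbrev PathFun : Type := ℝ≥0 → Pt

/-- Linear interpolation of a finite path. -/
def interp (w : Path) (t : ℝ) : Pt :=
  (1 - (t - (⌊t⌋₊ : ℝ))) • w.X ⌊t⌋₊ + (t - (⌊t⌋₊ : ℝ)) • w.X (⌊t⌋₊ + 1)

/-- The element of the continuous path space corresponding to `2^{-N} w`
(one time unit per lattice step). -/
def embedSc (N : ℕ) (w : Path) : PathFun := fun t => (((2:ℝ)^N)⁻¹) • interp w (t : ℝ)

/-- `Ŵ^N = 2^{-N} Ŵ_N`, as a set of continuous paths. -/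
def WHatSc (N : ℕ) : Set PathFun := {f | ∃ w, w ∈ WHat N ∧ f = embedSc N w}

/-- `Q^i v` for `v = 2^{-N} w ∈ W^N`: the coarse-grained path at scale `2^{-i}`. -/
def QSc (N i : ℕ) (w : Path) : PathFun := embedSc N (coarse (N - i) w)

/-- `Q̂^i v` for `v = 2^{-N} w ∈ W^N`: the loop-free coarse path at scale `2^{-i}`
(all loops of scale `≥ 2^{-i}` erased). -/
def QhatSc (N i : ℕ) (w : Path) : PathFun := embedSc N (Qhat N (N - i) w)

/-- The relation `w_N ▷ w_{N+1}`. -/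
def TriRel (N : ℕ) (a u : PathFun) : Prop :=
  ∃ v : Path, v ∈ WSet (N+1) ∧ a = QSc (N+1) N v ∧ u = QhatSc (N+1) (N+1) v

/-- `Ω'`: the set of consistent sequences `(w_0, w_1, w_2, …)`. -/
def GoodSeq : Set (ℕ → PathFun) :=
  {ω | (∀ N, ω N ∈ WHatSc N) ∧ ∀ N, TriRel N (ω N) (ω (N+1))}

/-- `P̂^N`: the joint law of `(Q̂^0 v, Q̂^1 v, …, Q̂^N v)` under the conditioned
random-walk law `P^N` on `W^N`. -/
def hatP (N : ℕ) : Measure (Fin (N+1) → PathFun) :=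
  Measure.sum fun w : WSet N =>
    ENNReal.ofReal (PW w.1) • Measure.dirac fun i : Fin (N+1) => QhatSc N i w.1

/-- The projection `π_N` onto the first `N+1` coordinates. -/
def projN (N : ℕ) (ω : ℕ → PathFun) : Fin (N+1) → PathFun := fun i => ω i

/-- `P` is the Kolmogorov-extension measure `P̂` of the projective family `(P̂^N)`:
a probability measure carried by `Ω'` whose finite-dimensional projections are the
laws `P̂^N` of the successive partial loop erasures of the conditioned walks. -/
def IsScalingLimitLaw (P : Measure (ℕ → PathFun)) : Prop :=
  IsProbabilityMeasure P ∧ P GoodSeq = 1 ∧ ∀ N, Measure.map (projN N) P = hatP N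

/-! ### The finite Sierpinski gasket and continuous-path skeletons -/

/-- The closed unit triangle `Δ_1` with vertices `O`, `a_0`, `b_0`. -/
def Delta1 : Set Pt := convexHull ℝ {ptO, ptA 0, ptB 0}

/-- Its reflection `Δ_2` in the `y`-axis. -/
def Delta2 : Set Pt := reflY '' Delta1

/-- `G^N = 2^{-N} G_0 ∩ (Δ_1 ∪ Δ_2)`. -/
def GFin (N : ℕ) : Set Pt :=
  ((fun p : Pt => (((2:ℝ)^N)⁻¹) • p) '' G0) ∩ (Delta1 ∪ Delta2)

/-- The finite Sierpinski gasket `F`. -/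
def Gasket : Set Pt := closure (⋃ N, GFin N)

/-- Successive hitting times of `G^M` by a continuous path. -/
def hitTC (M : ℕ) (w : PathFun) : ℕ → ℝ≥0
  | 0 => sInf {t | w t ∈ GFin M}
  | i+1 => sInf {t | hitTC M w i < t ∧ w t ∈ GFin M ∧ w t ≠ w (hitTC M w i)}

/-- Vertices of the upward `2^{-M}`-triangle with base point `z`. -/
def triVertsC (M : ℕ) (z : Pt) : Set Pt :=
  {z, z + (((2:ℝ)^M)⁻¹) • ptA 0, z + (((2:ℝ)^M)⁻¹) • ptB 0}

/-- The (closed, filled) upward `2^{-M}`-triangle with base point `z`. -/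
def triSetC (M : ℕ) (z : Pt) : Set Pt := convexHull ℝ (triVertsC M z)

/-- `z` is the base point of an upward `2^{-M}`-triangle with vertices in `G^M`. -/
def IsTriBaseC (M : ℕ) (z : Pt) : Prop :=
  z ∈ GFin M ∧ z + (((2:ℝ)^M)⁻¹) • ptA 0 ∈ GFin M ∧ z + (((2:ℝ)^M)⁻¹) • ptB 0 ∈ GFin M

/-- The base point of the (unique) upward `2^{-M}`-triangle having both `x` and `y`
among its vertices. -/
def triOfC (M : ℕ) (x y : Pt) : Pt :=
  Classical.epsilon fun z => IsTriBaseC M z ∧ x ∈ triVertsC M z ∧ y ∈ triVertsC M z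

/-- Exit times and triangle base points of the skeleton `σ^M(w)` of a continuous path. -/
def skelC (M : ℕ) (w : PathFun) : ℕ → ℝ≥0 × Pt
  | 0 => (hitTC M w 0, triOfC M (w (hitTC M w 0)) (w (hitTC M w 1)))
  | i+1 =>
    let e := (skelC M w i).1
    let z := (skelC M w i).2
    let jj := sInf {j : ℕ | e < hitTC M w j ∧ w (hitTC M w (j+1)) ∉ triSetC M z}
    (hitTC M w jj, triOfC M (w (hitTC M w jj)) (w (hitTC M w (jj+1))))

/-- `T_i^{ex,M}(w)` for a continuous path `w`. -/
def exitTC (M : ℕ) (w : PathFun) (i : ℕ) : ℝ≥0 := (skelC M w i).1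

/-- Base point of the triangle `Δ_{i+1}` of the skeleton `σ^M(w)` (`i = 0, 1, …`). -/
def triBaseC (M : ℕ) (w : PathFun) (i : ℕ) : Pt := (skelC M w i).2

/-- The arrival time at `a_0`. -/
def arrTC (w : PathFun) : ℝ≥0 := sInf {t | w t = ptA 0}

/-- The number of triangles in the skeleton `σ^M(w)`. -/
def numTriC (M : ℕ) (w : PathFun) : ℕ := sInf {k | exitTC M w k = arrTC w}

/-- Entrance hitting-index of the triangle `Δ_{i+1}` of `σ^M(w)`. -/
def entIdxC (M : ℕ) (w : PathFun) (i : ℕ) : ℕ := sInf {n | hitTC M w n = exitTC M w i}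

/-- The triangle `Δ_{i+1}` of `σ^M(w)` is of Type 1. -/
def IsType1C (M : ℕ) (w : PathFun) (i : ℕ) : Prop :=
  exitTC M w (i+1) = hitTC M w (entIdxC M w i + 1)

/-- The triangle `Δ_{i+1}` of `σ^M(w)` is of Type 2. -/
def IsType2C (M : ℕ) (w : PathFun) (i : ℕ) : Prop :=
  exitTC M w (i+1) = hitTC M w (entIdxC M w i + 2)

/-- The number of Type 1 triangles of the skeleton `σ^M(w)` contained in the region `A`
(the count `S_1^M(w|_A)`). -/
def S1in (M : ℕ) (A : Set Pt) (w : PathFun) : ℕ :=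
  ((Finset.range (numTriC M w)).filter fun i =>
    IsType1C M w i ∧ triSetC M (triBaseC M w i) ⊆ A).card

/-- The number of Type 2 triangles of the skeleton `σ^M(w)` contained in the region `A`
(the count `S_2^M(w|_A)`). -/
def S2in (M : ℕ) (A : Set Pt) (w : PathFun) : ℕ :=
  ((Finset.range (numTriC M w)).filter fun i =>
    IsType2C M w i ∧ triSetC M (triBaseC M w i) ⊆ A).card

/-- Equality of the `2^{-M}`-skeletons of two continuous paths. -/
def SkelCEq (M : ℕ) (u v : PathFun) : Prop :=
  numTriC M u = numTriC M v ∧ ∀ i, i < numTriC M u → triBaseC M u i = triBaseC M v i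

/-- The time-scaled process `X^N(t) = Y^N(λ^N t)`. -/
def Xproc (N : ℕ) (ω : ℕ → PathFun) : PathFun := fun t => ω N ((lamR ^ N).toNNReal * t)

/-- The conditional probability `P̂[ · | Y^M = v]`. -/
def condY (P : Measure (ℕ → PathFun)) (M : ℕ) (v : PathFun) : Measure (ℕ → PathFun) :=
  ProbabilityTheory.cond P {ω | ω M = v}

/-- The region of the plane occupied by the triangle `Δ_{i+1}` of `σ^M(v)`. -/
def triRegion (M : ℕ) (v : PathFun) (i : ℕ) : Set Pt := triSetC M (triBaseC M v i)

/-- `S^K(Y^K|_A) = (S_1^K(Y^K|_A), S_2^K(Y^K|_A))` as a function of `ω`. -/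
def SvecY (K : ℕ) (A : Set Pt) (ω : ℕ → PathFun) : ℕ × ℕ :=
  (S1in K A (ω K), S2in K A (ω K))

/-- `S^K(X^K|_A) = (S_1^K(X^K|_A), S_2^K(X^K|_A))` as a function of `ω`. -/
def SvecX (K : ℕ) (A : Set Pt) (ω : ℕ → PathFun) : ℕ × ℕ :=
  (S1in K A (Xproc K ω), S2in K A (Xproc K ω))

/-- The Laplace transform `φ(z) = Ê[exp(z B)]`, as a function on `ℂ`. -/
def laplaceT (P : Measure (ℕ → PathFun)) (B : (ℕ → PathFun) → ℝ) (z : ℂ) : ℂ :=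
  ∫ ω, Complex.exp (z * (B ω : ℂ)) ∂P

/-! ### Lattice coordinates -/

/-- Base points of the upward unit triangles of `F'_N`, in the lattice basis `(a_0, b_0)`. -/
def bases : ℕ → Set (ℤ × ℤ)
  | 0 => {0}
  | N+1 => {t | t ∈ bases N ∨ t - (2^N, 0) ∈ bases N ∨ t - (0, 2^N) ∈ bases N}

lemma mem_bases_succ {N : ℕ} {t : ℤ × ℤ} : t ∈ bases (N+1) ↔
    ∃ s ∈ bases N, t = (2 * s.1, 2 * s.2) ∨ t = (2 * s.1 + 1, 2 * s.2) ∨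
      t = (2 * s.1, 2 * s.2 + 1) := by
  induction N generalizing t with
  | zero =>
    obtain ⟨x, y⟩ := t
    simp [bases, Prod.ext_iff]
    omega
  | succ N ih =>
    obtain ⟨x, y⟩ := t
    have key : ∀ c d : ℤ,
        ((x, y) - ((2 * c, 2 * d) : ℤ × ℤ) ∈ bases (N+1) ↔
          ∃ s, s - (c, d) ∈ bases N ∧ ((x, y) = (2 * s.1, 2 * s.2) ∨
            (x, y) = (2 * s.1 + 1, 2 * s.2) ∨ (x, y) = (2 * s.1, 2 * s.2 + 1))) := by
      intro c d
      rw [ih]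
      constructor
      · rintro ⟨⟨s, r⟩, hs, h⟩
        refine ⟨(s + c, r + d), by simpa using hs, ?_⟩
        simp only [Prod.mk_sub_mk, Prod.mk.injEq] at h ⊢
        omega
      · rintro ⟨⟨s, r⟩, hs, h⟩
        refine ⟨(s - c, r - d), by simpa using hs, ?_⟩
        simp only [Prod.mk_sub_mk, Prod.mk.injEq] at h ⊢
        omega
    have h0 := key 0 0
    have h1 := key (2^N) 0
    have h2 := key 0 (2^N)
    simp only [mul_zero, ← pow_succ', Prod.mk_zero_zero, sub_zero] at h0 h1 h2
    have e : (x, y) ∈ bases (N+1+1) ↔ (x, y) ∈ bases (N+1) ∨ (x, y) - (2^(N+1), 0) ∈ bases (N+1) ∨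
      (x, y) - (0, 2^(N+1)) ∈ bases (N+1) := Iff.rfl
    rw [e, h0, h1, h2]
    simp only [← exists_or, ← or_and_right]
    rfl

/-- Reflection in the `y`-axis, acting on the base points of upward unit triangles. -/
def reflBase (t : ℤ × ℤ) : ℤ × ℤ := (t.1, -1 - t.1 - t.2)

/-- `t` is the base point of an upward unit triangle of `F_0`. -/
def IsBase (t : ℤ × ℤ) : Prop := ∃ N, t ∈ bases N ∨ reflBase t ∈ bases N

lemma bases_subset_succ {N : ℕ} {t : ℤ × ℤ} (h : t ∈ bases N) : t ∈ bases (N+1) := Or.inl h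

lemma isBase_iff_exists {t : ℤ × ℤ} : IsBase t ↔
    ∃ s, IsBase s ∧ (t = (2 * s.1, 2 * s.2) ∨ t = (2 * s.1 + 1, 2 * s.2) ∨
      t = (2 * s.1, 2 * s.2 + 1)) := by
  obtain ⟨x, y⟩ := t
  constructor
  · rintro ⟨N, h | h⟩
    · obtain ⟨s, hs, h⟩ := mem_bases_succ.1 (bases_subset_succ h)
      exact ⟨s, ⟨N, Or.inl hs⟩, h⟩
    · obtain ⟨s, hs, h⟩ := mem_bases_succ.1 (bases_subset_succ h)
      refine ⟨reflBase s, ⟨N, Or.inr (by simpa [reflBase] using hs)⟩, ?_⟩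
      simp only [reflBase, Prod.mk.injEq] at h ⊢
      omega
  · rintro ⟨s, ⟨N, hs | hs⟩, h⟩
    · exact ⟨N+1, Or.inl (mem_bases_succ.2 ⟨s, hs, h⟩)⟩
    · refine ⟨N+1, Or.inr (mem_bases_succ.2 ⟨_, hs, ?_⟩)⟩
      simp only [reflBase, Prod.mk.injEq] at h ⊢
      omega

@[simp] lemma isBase_even_even (x y : ℤ) : IsBase (2 * x, 2 * y) ↔ IsBase (x, y) := by
  rw [isBase_iff_exists]
  constructor
  · rintro ⟨⟨s, r⟩, hs, h⟩
    obtain ⟨rfl, rfl⟩ : x = s ∧ y = r := by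
      simp only [Prod.mk.injEq] at h
      omega
    exact hs
  · intro h
    exact ⟨_, h, by simp⟩

@[simp] lemma isBase_odd_even (x y : ℤ) : IsBase (2 * x + 1, 2 * y) ↔ IsBase (x, y) := by
  rw [isBase_iff_exists]
  constructor
  · rintro ⟨⟨s, r⟩, hs, h⟩
    obtain ⟨rfl, rfl⟩ : x = s ∧ y = r := by
      simp only [Prod.mk.injEq] at h
      omega
    exact hs
  · intro h
    exact ⟨_, h, by simp⟩

@[simp] lemma isBase_even_odd (x y : ℤ) : IsBase (2 * x, 2 * y + 1) ↔ IsBase (x, y) := by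
  rw [isBase_iff_exists]
  constructor
  · rintro ⟨⟨s, r⟩, hs, h⟩
    obtain ⟨rfl, rfl⟩ : x = s ∧ y = r := by
      simp only [Prod.mk.injEq] at h
      omega
    exact hs
  · intro h
    exact ⟨_, h, by simp⟩

@[simp] lemma not_isBase_odd_odd (x y : ℤ) : ¬ IsBase (2 * x + 1, 2 * y + 1) := by
  rw [isBase_iff_exists]
  rintro ⟨⟨s, r⟩, hs, h⟩
  simp only [Prod.mk.injEq] at h
  omega

lemma bases_nonneg {N : ℕ} {t : ℤ × ℤ} (h : t ∈ bases N) : 0 ≤ t.1 := by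
  induction N generalizing t with
  | zero => simp [bases] at h; simp [h]
  | succ N ih =>
    obtain ⟨s, hs, h⟩ := mem_bases_succ.1 h
    have := ih hs
    rcases h with rfl | rfl | rfl <;> simp <;> omega

lemma IsBase.nonneg {t : ℤ × ℤ} (h : IsBase t) : 0 ≤ t.1 := by
  obtain ⟨N, h | h⟩ := h
  · exact bases_nonneg h
  · simpa [reflBase] using bases_nonneg h

/-- Lattice coordinates of the vertices of `F_0`. -/
def IsVert (v : ℤ × ℤ) : Prop :=
  IsBase (v.1, v.2) ∨ IsBase (v.1 - 1, v.2) ∨ IsBase (v.1, v.2 - 1)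

lemma exists_parity (v : ℤ × ℤ) : ∃ x y : ℤ, v = (2 * x, 2 * y) ∨ v = (2 * x + 1, 2 * y) ∨
    v = (2 * x, 2 * y + 1) ∨ v = (2 * x + 1, 2 * y + 1) := by
  obtain ⟨a, b⟩ := v
  refine ⟨a / 2, b / 2, ?_⟩
  simp only [Prod.mk.injEq]
  omega

lemma isBase_sub_one_left (x y : ℤ) : IsBase (2 * x - 1, 2 * y) ↔ IsBase (x - 1, y) := by
  rw [show 2 * x - 1 = 2 * (x - 1) + 1 by ring, isBase_odd_even]

lemma isBase_sub_one_right (x y : ℤ) : IsBase (2 * x, 2 * y - 1) ↔ IsBase (x, y - 1) := by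
  rw [show 2 * y - 1 = 2 * (y - 1) + 1 by ring, isBase_even_odd]

lemma not_isBase_odd_sub (x y : ℤ) : ¬ IsBase (2 * x + 1, 2 * y - 1) := by
  have := not_isBase_odd_odd x (y - 1)
  ring_nf at this ⊢; exact this

lemma not_isBase_sub_odd (x y : ℤ) : ¬ IsBase (2 * x - 1, 2 * y + 1) := by
  have := not_isBase_odd_odd (x - 1) y
  ring_nf at this ⊢; exact this

lemma isVert_two_mul (x y : ℤ) : IsVert (2 * x, 2 * y) ↔ IsVert (x, y) := by
  simp [IsVert, isBase_sub_one_left, isBase_sub_one_right]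

/-- Every vertex of `F_0` belongs to exactly two of the three possible unit triangles. -/
lemma IsVert.two_triangles {v : ℤ × ℤ} (h : IsVert v) :
    (IsBase (v.1, v.2) ∧ IsBase (v.1 - 1, v.2) ∧ ¬ IsBase (v.1, v.2 - 1)) ∨
    (IsBase (v.1, v.2) ∧ ¬ IsBase (v.1 - 1, v.2) ∧ IsBase (v.1, v.2 - 1)) ∨
    (¬ IsBase (v.1, v.2) ∧ IsBase (v.1 - 1, v.2) ∧ IsBase (v.1, v.2 - 1)) := by
  induction hn : v.1.natAbs + v.2.natAbs using Nat.strong_induction_on generalizing v with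
  | _ n ih =>
  obtain ⟨x, y, rfl | rfl | rfl | rfl⟩ := exists_parity v
  · by_cases h0 : x = 0 ∧ y = 0
    · obtain ⟨rfl, rfl⟩ := h0
      right; left
      refine ⟨⟨0, Or.inl (by simp [bases])⟩, fun h => ?_, ⟨0, Or.inr (by simp [bases, reflBase])⟩⟩
      simpa using h.nonneg
    · have := ih (x.natAbs + y.natAbs) (by simp at hn; omega) ((isVert_two_mul x y).1 h) rfl
      simpa [isBase_sub_one_left, isBase_sub_one_right] using this
  · simp [IsVert, not_isBase_odd_sub] at h ⊢; exact h
  · simp [IsVert, not_isBase_sub_odd] at h ⊢; exact h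
  · simp [IsVert] at h ⊢; exact h

/-- The neighbours of `v` in `F_0`. -/
def nbr (v : ℤ × ℤ) : Finset (ℤ × ℤ) :=
  (if IsBase (v.1, v.2) then {(v.1 + 1, v.2), (v.1, v.2 + 1)} else ∅) ∪
  ((if IsBase (v.1 - 1, v.2) then {(v.1 - 1, v.2), (v.1 - 1, v.2 + 1)} else ∅) ∪
  (if IsBase (v.1, v.2 - 1) then {(v.1, v.2 - 1), (v.1 + 1, v.2 - 1)} else ∅))

lemma sum_nbr (f : ℤ × ℤ → ℝ) (v : ℤ × ℤ) : ∑ z ∈ nbr v, f z =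
    (if IsBase (v.1, v.2) then f (v.1 + 1, v.2) + f (v.1, v.2 + 1) else 0) +
    ((if IsBase (v.1 - 1, v.2) then f (v.1 - 1, v.2) + f (v.1 - 1, v.2 + 1) else 0) +
    (if IsBase (v.1, v.2 - 1) then f (v.1, v.2 - 1) + f (v.1 + 1, v.2 - 1) else 0)) := by
  have pair : ∀ (p : Prop) (a b : ℤ × ℤ), a ≠ b →
      ∑ z ∈ (if p then ({a, b} : Finset (ℤ × ℤ)) else ∅), f z = if p then f a + f b else 0 := by
    intro p a b hab
    split_ifs
    · exact Finset.sum_pair hab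
    · simp
  rw [nbr, Finset.sum_union, Finset.sum_union, pair, pair, pair]
  · simp
  · simp
  · simp
  · rw [Finset.disjoint_left]
    intro a ha hb
    split_ifs at ha hb <;> simp at ha hb
    rcases ha with rfl | rfl <;> simp [Prod.ext_iff] at hb <;> omega
  · rw [Finset.disjoint_left]
    intro a ha hb
    rw [Finset.mem_union] at hb
    split_ifs at ha hb <;> simp at ha hb <;>
    rcases ha with rfl | rfl <;> simp [Prod.ext_iff] at hb <;> omega

lemma card_nbr {v : ℤ × ℤ} (h : IsVert v) : ((nbr v).card : ℝ) = 4 := by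
  have := sum_nbr (fun _ => 1) v
  simp only [Finset.sum_const, nsmul_eq_mul, mul_one] at this
  rw [this]
  rcases h.two_triangles with ⟨h1, h2, h3⟩ | ⟨h1, h2, h3⟩ | ⟨h1, h2, h3⟩ <;>
    simp [h1, h2, h3] <;> norm_num

/-- The corners of the upward unit triangle based at the origin. -/
abbrev corners : Finset (ℤ × ℤ) := {(0, 0), (1, 0), (0, 1)}

lemma mem_nbr {z z' : ℤ × ℤ} : z' ∈ nbr z ↔ ∃ t, IsBase t ∧
    ∃ d ∈ corners, ∃ d' ∈ corners, d ≠ d' ∧ z = t + d ∧ z' = t + d' := by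
  obtain ⟨x, y⟩ := z
  obtain ⟨x', y'⟩ := z'
  have mem_ite : ∀ (p : Prop) (a b : ℤ × ℤ),
      (x', y') ∈ (if p then ({a, b} : Finset (ℤ × ℤ)) else ∅) ↔
        p ∧ ((x', y') = a ∨ (x', y') = b) := by
    intro p a b
    split_ifs with h <;> simp [h]
  simp only [nbr, Finset.mem_union, mem_ite]
  constructor
  · rintro (⟨h, h'⟩ | ⟨h, h'⟩ | ⟨h, h'⟩)
    · refine ⟨_, h, (0, 0), by simp, ?_⟩
      rcases h' with h' | h'
      · exact ⟨(1, 0), by simp, by simp, by simp, by rw [h']; simp⟩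
      · exact ⟨(0, 1), by simp, by simp, by simp, by rw [h']; simp⟩
    · refine ⟨_, h, (1, 0), by simp, ?_⟩
      rcases h' with h' | h'
      · exact ⟨(0, 0), by simp, by simp, by simp, by rw [h']; simp⟩
      · exact ⟨(0, 1), by simp, by simp, by simp, by rw [h']; simp⟩
    · refine ⟨_, h, (0, 1), by simp, ?_⟩
      rcases h' with h' | h'
      · exact ⟨(0, 0), by simp, by simp, by simp, by rw [h']; simp⟩
      · exact ⟨(1, 0), by simp, by simp, by simp, by rw [h']; simp⟩
  · rintro ⟨⟨r, s⟩, ht, d, hd, d', hd', hne, h, h'⟩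
    simp only [Finset.mem_insert, Finset.mem_singleton] at hd hd'
    rcases hd with rfl | rfl | rfl <;> rcases hd' with rfl | rfl | rfl <;>
      simp at hne h h' <;> obtain ⟨rfl, rfl⟩ := h <;> obtain ⟨rfl, rfl⟩ := h' <;> simp [ht]

lemma isVert_iff {z : ℤ × ℤ} : IsVert z ↔ ∃ t, IsBase t ∧
    ∃ d ∈ corners, z = t + d := by
  obtain ⟨x, y⟩ := z
  constructor
  · rintro (h | h | h)
    · exact ⟨_, h, (0, 0), by simp, by simp⟩
    · exact ⟨_, h, (1, 0), by simp, by simp⟩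
    · exact ⟨_, h, (0, 1), by simp, by simp⟩
  · rintro ⟨⟨r, s⟩, ht, d, hd, h⟩
    simp only [Finset.mem_insert, Finset.mem_singleton] at hd
    rcases hd with rfl | rfl | rfl <;> simp at h <;> obtain ⟨rfl, rfl⟩ := h <;> simp [IsVert, ht]

lemma isVert_of_mem_nbr {z z' : ℤ × ℤ} (h : z' ∈ nbr z) : IsVert z' := by
  obtain ⟨t, ht, d, hd, d', hd', -, -, rfl⟩ := mem_nbr.1 h
  exact isVert_iff.2 ⟨t, ht, d', hd', rfl⟩

lemma ne_of_mem_nbr {z z' : ℤ × ℤ} (h : z' ∈ nbr z) : z' ≠ z := by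
  obtain ⟨t, ht, d, hd, d', hd', hne, rfl, rfl⟩ := mem_nbr.1 h
  simpa using hne.symm

lemma isVert_pow_smul (M : ℕ) (x : ℤ × ℤ) : IsVert ((2:ℤ)^M • x) ↔ IsVert x := by
  induction M with
  | zero => simp
  | succ M ih => rw [← ih, pow_succ', mul_smul]; exact isVert_two_mul _ _

/-! ### Harmonic extension -/

/-- Extension of a function from the vertices of `F_1` to those of `F_0` (in coordinates of the
respective lattices) by the harmonic rule, plus the constant `c` at the midpoints. -/
def harmExt (c : ℝ) (g : ℤ × ℤ → ℝ) (v : ℤ × ℤ) : ℝ :=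
  let x := v.1 / 2
  let y := v.2 / 2
  if v.1 % 2 = 0 then
    if v.2 % 2 = 0 then g (x, y)
    else (2 * g (x, y) + 2 * g (x, y + 1) + g (x + 1, y)) / 5 + c
  else
    if v.2 % 2 = 0 then (2 * g (x, y) + 2 * g (x + 1, y) + g (x, y + 1)) / 5 + c
    else (2 * g (x + 1, y) + 2 * g (x, y + 1) + g (x, y)) / 5 + c

section HarmExt

variable (c : ℝ) (g : ℤ × ℤ → ℝ) (x y : ℤ)

lemma harmExt_even_even : harmExt c g (2 * x, 2 * y) = g (x, y) := by
  simp [harmExt]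

lemma harmExt_odd_even : harmExt c g (2 * x + 1, 2 * y) =
    (2 * g (x, y) + 2 * g (x + 1, y) + g (x, y + 1)) / 5 + c := by
  have : (2 * x + 1) / 2 = x := by omega
  simp [harmExt, this]

lemma harmExt_even_odd : harmExt c g (2 * x, 2 * y + 1) =
    (2 * g (x, y) + 2 * g (x, y + 1) + g (x + 1, y)) / 5 + c := by
  have : (2 * y + 1) / 2 = y := by omega
  simp [harmExt, this]

lemma harmExt_odd_odd : harmExt c g (2 * x + 1, 2 * y + 1) =
    (2 * g (x + 1, y) + 2 * g (x, y + 1) + g (x, y)) / 5 + c := by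
  have h : (2 * y + 1) / 2 = y := by omega
  have : (2 * x + 1) / 2 = x := by omega
  simp [harmExt, this, h]

end HarmExt

lemma sum_nbr_harmExt_even (c : ℝ) (g : ℤ × ℤ → ℝ) {x : ℤ × ℤ} (h : IsVert x) :
    ∑ z ∈ nbr ((2:ℤ) • x), harmExt c g z = (8 * g x + 3 * ∑ z ∈ nbr x, g z) / 5 + 4 * c := by
  obtain ⟨x, y⟩ := x
  have e1 : (2 * x - 1, 2 * y) = (2 * (x - 1) + 1, 2 * y) := by ring_nf
  have e2 : (2 * x - 1, 2 * y + 1) = (2 * (x - 1) + 1, 2 * y + 1) := by ring_nf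
  have e3 : (2 * x, 2 * y - 1) = (2 * x, 2 * (y - 1) + 1) := by ring_nf
  have e4 : (2 * x + 1, 2 * y - 1) = (2 * x + 1, 2 * (y - 1) + 1) := by ring_nf
  simp only [sum_nbr, Prod.smul_mk, smul_eq_mul, e1, e2, e3, e4, isBase_even_even,
    isBase_odd_even, isBase_even_odd, harmExt_odd_even, harmExt_even_odd, harmExt_odd_odd,
    sub_add_cancel]
  rcases h.two_triangles with ⟨h1, h2, h3⟩ | ⟨h1, h2, h3⟩ | ⟨h1, h2, h3⟩ <;>
    dsimp only at h1 h2 h3 <;> simp only [h1, h2, h3, if_true, if_false] <;> ring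

lemma sum_nbr_harmExt_odd (c : ℝ) (g : ℤ × ℤ → ℝ) {v : ℤ × ℤ} (h : IsVert v)
    (hv : ∀ x : ℤ × ℤ, v ≠ (2:ℤ) • x) :
    ∑ z ∈ nbr v, harmExt c g z = 4 * harmExt c g v - 2 * c := by
  obtain ⟨x, y, rfl | rfl | rfl | rfl⟩ := exists_parity v
  · exact absurd rfl (hv (x, y))
  · have e1 : (2 * x + 1 + 1, 2 * y) = (2 * (x + 1), 2 * y) := by ring_nf
    have hb : IsBase (x, y) := by simpa [IsVert, not_isBase_odd_sub] using h
    simp only [sum_nbr, e1, isBase_even_even, add_sub_cancel_right, not_isBase_odd_sub,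
      isBase_odd_even, hb, if_true, if_false, harmExt_odd_even, harmExt_even_odd, harmExt_odd_odd,
      harmExt_even_even]
    ring
  · have e1 : (2 * x, 2 * y + 1 + 1) = (2 * x, 2 * (y + 1)) := by ring_nf
    have hb : IsBase (x, y) := by simpa [IsVert, not_isBase_sub_odd] using h
    simp only [sum_nbr, e1, isBase_even_even, add_sub_cancel_right, not_isBase_sub_odd,
      isBase_even_odd, hb, if_true, if_false, harmExt_odd_even, harmExt_even_odd, harmExt_odd_odd,
      harmExt_even_even]
    ring
  · have e1 : (2 * x, 2 * y + 1 + 1) = (2 * x, 2 * (y + 1)) := by ring_nf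
    have e2 : (2 * x + 1 + 1, 2 * y) = (2 * (x + 1), 2 * y) := by ring_nf
    have hb : IsBase (x, y) := by simpa [IsVert] using h
    simp only [sum_nbr, e1, e2, isBase_odd_even, add_sub_cancel_right, not_isBase_odd_odd,
      isBase_even_odd, hb, if_true, if_false, harmExt_odd_even, harmExt_even_odd, harmExt_odd_odd,
      harmExt_even_even]
    ring

/-- The `M`-fold iterate of `g ↦ harmExt c (s * g)`, from the vertices of `F_M` to those of
`F_0`. -/
def iterExt (s c : ℝ) (g : ℤ × ℤ → ℝ) : ℕ → ℤ × ℤ → ℝ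
  | 0 => g
  | M+1 => harmExt c fun z => s * iterExt s c g M z

lemma iterExt_pow_smul (s c : ℝ) (g : ℤ × ℤ → ℝ) (M : ℕ) (x : ℤ × ℤ) :
    iterExt s c g M ((2:ℤ)^M • x) = s^M * g x := by
  induction M with
  | zero => simp [iterExt]
  | succ M ih =>
    rw [pow_succ', mul_smul, pow_succ', mul_assoc, ← ih]
    exact harmExt_even_even _ _ _ _

lemma harmExt_mem_Icc {c C : ℝ} {g : ℤ × ℤ → ℝ} (hc : 0 ≤ c) (hg : ∀ z, 0 ≤ g z ∧ g z ≤ C)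
    (z : ℤ × ℤ) : 0 ≤ harmExt c g z ∧ harmExt c g z ≤ C + c := by
  have h1 := hg (z.1 / 2, z.2 / 2)
  have h2 := hg (z.1 / 2 + 1, z.2 / 2)
  have h3 := hg (z.1 / 2, z.2 / 2 + 1)
  simp only [harmExt]
  split_ifs <;> constructor <;> linarith

lemma iterExt_nonneg {s c : ℝ} (hs : 0 ≤ s) (hc : 0 ≤ c) {g : ℤ × ℤ → ℝ} (hg : ∀ z, 0 ≤ g z)
    (M : ℕ) (z : ℤ × ℤ) : 0 ≤ iterExt s c g M z := by
  induction M generalizing z with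
  | zero => exact hg z
  | succ M ih =>
    have h1 := mul_nonneg hs (ih (z.1 / 2, z.2 / 2))
    have h2 := mul_nonneg hs (ih (z.1 / 2 + 1, z.2 / 2))
    have h3 := mul_nonneg hs (ih (z.1 / 2, z.2 / 2 + 1))
    simp only [iterExt, harmExt]
    split_ifs <;> linarith

lemma iterExt_le {C : ℝ} {g : ℤ × ℤ → ℝ} (hg : ∀ z, 0 ≤ g z ∧ g z ≤ C)
    (M : ℕ) (z : ℤ × ℤ) : 0 ≤ iterExt 1 0 g M z ∧ iterExt 1 0 g M z ≤ C := by
  induction M generalizing z with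
  | zero => exact hg z
  | succ M ih => simpa [iterExt] using harmExt_mem_Icc le_rfl ih z

/-- If the Laplacian of `g` at the vertex of `F_M` located at `z`, if any, is equal to `δ`, then so
is that of the iterated extension of `g` at `z`. -/
lemma laplacian_iterExt {s c δ : ℝ} (h1 : δ = -2 * c) (h2 : s * 3 / 5 * δ + 4 * c = δ)
    (g : ℤ × ℤ → ℝ) (M : ℕ) {z : ℤ × ℤ} (hz : IsVert z)
    (hg : ∀ x, z = (2:ℤ)^M • x → ∑ y ∈ nbr x, g y - 4 * g x = δ) :
    ∑ y ∈ nbr z, iterExt s c g M y = 4 * iterExt s c g M z + δ := by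
  induction M generalizing z with
  | zero => have := hg z (by simp); simp only [iterExt]; linarith
  | succ M ih =>
    by_cases he : ∃ x : ℤ × ℤ, z = (2:ℤ) • x
    · obtain ⟨x, rfl⟩ := he
      have hx : IsVert x := (isVert_two_mul _ _).1 hz
      have := ih hx fun x' hx' => hg x' (by rw [hx', pow_succ', mul_smul])
      simp only [iterExt]
      rw [sum_nbr_harmExt_even _ _ hx, ← Finset.mul_sum, this]
      have e : harmExt c (fun z => s * iterExt s c g M z) ((2:ℤ) • x) = s * iterExt s c g M x :=
        harmExt_even_even _ _ _ _
      rw [e]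
      linarith
    · push Not at he
      simp only [iterExt]
      rw [sum_nbr_harmExt_odd _ _ hz he]
      linarith

/-! ### Absorption of sub-Markov chains -/

/-- If `Φ = d + P Φ`, `Φ` is dominated by `A + d`, and the expected time spent in `A` is finite
(as witnessed by `Ψ`), then `Φ` is the sum of `Pⁿ d`. -/
lemma hasSum_pow_of_harmonic {S : Type*} (P : (S → ℝ) →ₗ[ℝ] (S → ℝ))
    (hP : ∀ f, 0 ≤ f → 0 ≤ P f) {Φ Ψ A d : S → ℝ} {C : ℝ} (hd : 0 ≤ d) (hA : 0 ≤ A)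
    (hΦ : Φ = d + P Φ) (hΦ0 : 0 ≤ Φ) (hΦA : Φ ≤ C • (A + d))
    (hΨ0 : 0 ≤ Ψ) (hΨ : A + P Ψ ≤ Ψ) (s : S) :
    HasSum (fun n => (P ^ n) d s) (Φ s) := by
  have hpos : ∀ n f, 0 ≤ f → 0 ≤ (P ^ n) f := by
    intro n
    induction n with
    | zero => intro f hf; simpa using hf
    | succ n ih => intro f hf; rw [pow_succ]; exact ih _ (hP f hf)
  have hmono : ∀ n f g, f ≤ g → (P ^ n) f ≤ (P ^ n) g := by
    intro n f g hfg
    have := hpos n (g - f) (sub_nonneg.2 hfg)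
    rwa [map_sub, sub_nonneg] at this
  have hΦn : ∀ n, Φ = ∑ j ∈ Finset.range n, (P ^ j) d + (P ^ n) Φ := by
    intro n
    induction n with
    | zero => simp
    | succ n ih =>
      rw [Finset.sum_range_succ, add_assoc, pow_succ, Module.End.mul_apply, ← map_add, ← hΦ]
      exact ih
  have hΨn : ∀ n, ∑ j ∈ Finset.range n, (P ^ j) A + (P ^ n) Ψ ≤ Ψ := by
    intro n
    induction n with
    | zero => simp
    | succ n ih =>
      rw [Finset.sum_range_succ, add_assoc, pow_succ, Module.End.mul_apply, ← map_add]
      exact (add_le_add_right (hmono n _ _ hΨ) _).trans ih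
  have sA : Summable fun n => (P ^ n) A s := by
    refine summable_of_sum_range_le (c := Ψ s) (fun n => hpos n _ hA s) fun n => ?_
    have h1 := hΨn n s
    have h2 := hpos n _ hΨ0 s
    simp only [Pi.add_apply, Finset.sum_apply, Pi.zero_apply] at h1 h2
    linarith
  have sd : Summable fun n => (P ^ n) d s := by
    refine summable_of_sum_range_le (c := Φ s) (fun n => hpos n _ hd s) fun n => ?_
    have h1 := congrFun (hΦn n) s
    have h2 := hpos n _ hΦ0 s
    simp only [Pi.add_apply, Finset.sum_apply, Pi.zero_apply] at h1 h2
    linarith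
  have hlim : Tendsto (fun n => (P ^ n) Φ s) atTop (𝓝 0) := by
    have hup := (sA.tendsto_atTop_zero.add sd.tendsto_atTop_zero).const_mul C
    rw [add_zero, mul_zero] at hup
    refine squeeze_zero (fun n => hpos n _ hΦ0 s) (fun n => ?_) hup
    have := hmono n _ _ hΦA s
    rw [map_smul, map_add] at this
    exact this
  rw [hasSum_iff_tendsto_nat_of_nonneg (fun n => hpos n _ hd s)]
  have : (fun n => ∑ i ∈ Finset.range n, (P ^ i) d s) = fun n => Φ s - (P ^ n) Φ s := by
    funext n
    have h1 := congrFun (hΦn n) s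
    simp only [Pi.add_apply, Finset.sum_apply] at h1
    linarith
  rw [this]
  simpa using hlim.const_sub (Φ s)

/-! ### Walks following a coarse path -/

section Follow

variable (M k : ℕ) (v : ℕ → ℤ × ℤ)

/-- The value at the state reached from a state of index `i` by a step to `z`: the index of the
last visited vertex of the coarse path `v` is updated, and the value is `e` if the step hits a
wrong vertex of the coarse graph. -/
def stepVal {α : Type*} (e : α) (f : ℤ × ℤ → ℕ → α) (i : ℕ) (z : ℤ × ℤ) : α :=
  if z = (2:ℤ)^M • v (i + 1) then f z (i + 1)
  else if (∃ x, z = (2:ℤ)^M • x) ∧ z ≠ (2:ℤ)^M • v i then e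
  else f z i

/-- The states from which a walk following the coarse path `v_0, …, v_k` continues. -/
def Alive (s : (ℤ × ℤ) × ℕ) : Prop :=
  s.2 < k ∧ IsVert s.1 ∧ ∀ x, s.1 = (2:ℤ)^M • x → x = v s.2

/-- The final state of a walk following the coarse path `v_0, …, v_k`. -/
def IsDone (s : (ℤ × ℤ) × ℕ) : Prop := s.2 = k ∧ s.1 = (2:ℤ)^M • v k

/-- The transition operator of simple random walk killed on leaving the coarse path `v`. -/
def stepOp : ((ℤ × ℤ) × ℕ → ℝ) →ₗ[ℝ] ((ℤ × ℤ) × ℕ → ℝ) where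
  toFun f s := if Alive M k v s then
    1/4 * ∑ z ∈ nbr s.1, stepVal M v 0 (fun z i => f (z, i)) s.2 z else 0
  map_add' f g := by
    funext s
    simp only [Pi.add_apply]
    split_ifs
    · rw [← mul_add]
      congr 1
      rw [← Finset.sum_add_distrib]
      refine Finset.sum_congr rfl fun z _ => ?_
      simp only [stepVal]
      split_ifs <;> simp
    · simp
  map_smul' c f := by
    funext s
    simp only [Pi.smul_apply, smul_eq_mul, RingHom.id_apply]
    split_ifs
    · rw [mul_left_comm, Finset.mul_sum _ _ c]
      congr 1
      refine Finset.sum_congr rfl fun z _ => ?_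
      simp only [stepVal]
      split_ifs <;> simp
    · simp

lemma stepOp_apply (f : (ℤ × ℤ) × ℕ → ℝ) (s : (ℤ × ℤ) × ℕ) :
    stepOp M k v f s = if Alive M k v s then
      1/4 * ∑ z ∈ nbr s.1, stepVal M v 0 (fun z i => f (z, i)) s.2 z else 0 := rfl

/-- Prepend a point to a sequence. -/
def consSeq (z : ℤ × ℤ) (p : ℕ → ℤ × ℤ) : ℕ → ℤ × ℤ
  | 0 => z
  | j+1 => p j

/-- The walks with `n` steps from the state `(z, i)` to the final state. -/
def walks : ℕ → ℤ × ℤ → ℕ → Finset (ℕ → ℤ × ℤ)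
  | 0, z, i => if IsDone M k v (z, i) then {fun _ => z} else ∅
  | n+1, z, i => if Alive M k v (z, i) then
      (nbr z).biUnion fun z' => (stepVal M v ∅ (walks n) i z').image (consSeq z) else ∅

lemma consSeq_injective (z : ℤ × ℤ) : Function.Injective (consSeq z) :=
  fun _ _ h => funext fun j => congrFun h (j + 1)

variable {M k v}

lemma apply_zero_of_mem_walks {n : ℕ} {z : ℤ × ℤ} {i : ℕ} {p : ℕ → ℤ × ℤ}
    (h : p ∈ walks M k v n z i) : p 0 = z := by
  cases n with
  | zero =>
    simp only [walks] at h
    split_ifs at h <;> simp at h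
    simp [h]
  | succ n =>
    simp only [walks] at h
    split_ifs at h <;> simp at h
    obtain ⟨-, -, -, q, -, rfl⟩ := h
    rfl

lemma apply_zero_of_mem_stepVal {n : ℕ} {z : ℤ × ℤ} {i : ℕ} {p : ℕ → ℤ × ℤ}
    (h : p ∈ stepVal M v ∅ (walks M k v n) i z) : p 0 = z := by
  simp only [stepVal] at h
  split_ifs at h
  · exact apply_zero_of_mem_walks h
  · simp at h
  · exact apply_zero_of_mem_walks h

variable (M k v)

/-- The probability that the walk reaches the final state in exactly `n` steps. -/
lemma stepOp_pow_done (n : ℕ) (z : ℤ × ℤ) (i : ℕ) :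
    ((stepOp M k v) ^ n) (fun s => if IsDone M k v s then 1 else 0) (z, i) =
      (walks M k v n z i).card * (1/4 : ℝ)^n := by
  induction n generalizing z i with
  | zero => simp only [walks]; split_ifs with h <;> simp [h]
  | succ n ih =>
    rw [pow_succ', Module.End.mul_apply]
    rw [stepOp_apply]
    simp only [walks]
    split_ifs
    · rw [Finset.card_biUnion]
      · push_cast
        rw [Finset.sum_mul, Finset.mul_sum]
        refine Finset.sum_congr rfl fun z' _ => ?_
        rw [Finset.card_image_of_injective _ (consSeq_injective z)]
        simp only [stepVal]
        split_ifs
        · rw [ih, pow_succ]; ring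
        · simp
        · rw [ih, pow_succ]; ring
      · intro z1 _ z2 _ hne
        rw [Function.onFun, Finset.disjoint_left]
        intro p hp1 hp2
        obtain ⟨q1, h1, rfl⟩ := Finset.mem_image.1 hp1
        obtain ⟨q2, h2, h⟩ := Finset.mem_image.1 hp2
        obtain rfl := consSeq_injective z h
        exact hne ((apply_zero_of_mem_stepVal h1).symm.trans (apply_zero_of_mem_stepVal h2))
    · simp

lemma smul_pow_injective : Function.Injective fun x : ℤ × ℤ => (2:ℤ)^M • x := by
  intro x y h
  simpa [Prod.ext_iff] using h

/-- The probability, started at the `i`-th vertex of the coarse path, of following it. -/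
lemma hasSum_card_walks (hk : 0 < k) (hv : ∀ i < k, IsVert (v i) ∧ v (i + 1) ∈ nbr (v i)) :
    HasSum (fun n => ((walks M k v n ((2:ℤ)^M • v 0) 0).card : ℝ) * (1/4 : ℝ)^n)
      ((1/4 : ℝ)^k) := by
  have inj : ∀ x y : ℤ × ℤ, (2:ℤ)^M • x = (2:ℤ)^M • y ↔ x = y :=
    fun x y => (smul_pow_injective M).eq_iff
  set P := stepOp M k v with hP
  set d : (ℤ × ℤ) × ℕ → ℝ := fun s => if IsDone M k v s then 1 else 0 with hd
  set A : (ℤ × ℤ) × ℕ → ℝ := fun s => if Alive M k v s then 1 else 0 with hA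
  set g : ℕ → ℤ × ℤ → ℝ := fun i x => if x = v i then 1 else if x = v (i + 1) then 4 else 0 with hg
  set g' : ℕ → ℤ × ℤ → ℝ := fun i x => if x = v i then 1 else 0 with hg'
  set Φ : (ℤ × ℤ) × ℕ → ℝ := fun s => if Alive M k v s then
    (1/4 : ℝ)^(k - s.2) * iterExt 1 0 (g s.2) M s.1 else d s with hΦ
  set Ψ : (ℤ × ℤ) × ℕ → ℝ := fun s => if Alive M k v s then
    iterExt 5 2 (g' s.2) M s.1 + ((k : ℝ) - s.2 - 1) * 5^M else 0 with hΨ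
  have hg0 : ∀ i z, 0 ≤ g i z ∧ g i z ≤ 4 := by
    intro i z; simp only [hg]; split_ifs <;> norm_num
  have hg'0 : ∀ i z, 0 ≤ g' i z := by
    intro i z; simp only [hg']; split_ifs <;> norm_num
  have not_alive : ∀ s, IsDone M k v s → ¬ Alive M k v s :=
    fun s h h' => h'.1.ne h.1
  have alive_vert : ∀ i < k, IsVert ((2:ℤ)^M • v i) → Alive M k v ((2:ℤ)^M • v i, i) :=
    fun i hi h => ⟨hi, h, fun x hx => ((inj _ _).1 hx).symm⟩
  have hne : ∀ i < k, v (i + 1) ≠ v i := fun i hi => ne_of_mem_nbr (hv i hi).2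
  have lap : ∀ i < k, ∑ y ∈ nbr (v i), g i y - 4 * g i (v i) = 0 := by
    intro i hi
    have : ∑ y ∈ nbr (v i), g i y = ∑ y ∈ nbr (v i), if y = v (i + 1) then (4:ℝ) else 0 := by
      refine Finset.sum_congr rfl fun y hy => ?_
      simp [hg, ne_of_mem_nbr hy]
    rw [this, Finset.sum_ite_eq', if_pos (hv i hi).2]
    simp [hg]
  have lap' : ∀ i < k, ∑ y ∈ nbr (v i), g' i y - 4 * g' i (v i) = -4 := by
    intro i hi
    have : ∑ y ∈ nbr (v i), g' i y = 0 := by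
      refine Finset.sum_eq_zero fun y hy => ?_
      simp [hg', ne_of_mem_nbr hy]
    rw [this]
    simp [hg']
  have step : ∀ i < k, ∀ z, IsVert z → stepVal M v 0 (fun z i => Φ (z, i)) i z =
      (1/4 : ℝ)^(k - i) * iterExt 1 0 (g i) M z := by
    intro i hi z hz
    simp only [stepVal]
    split_ifs with h1 h2
    · subst h1
      rw [iterExt_pow_smul]
      simp only [hg, hne i hi, if_false, if_true]
      rcases eq_or_lt_of_le (Nat.succ_le_of_lt hi) with h | h
      · have hD : IsDone M k v ((2:ℤ)^M • v (i + 1), i + 1) := ⟨h, by rw [← h]⟩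
        simp only [hΦ, if_neg (not_alive _ hD), hd, if_pos hD]
        rw [show k - i = 1 by omega]
        norm_num
      · have hD := alive_vert (i + 1) h hz
        simp only [hΦ, if_pos hD]
        rw [iterExt_pow_smul, show k - i = k - (i + 1) + 1 by omega, pow_succ]
        simp only [hg, if_true]
        ring
    · obtain ⟨⟨x, rfl⟩, h2⟩ := h2
      rw [iterExt_pow_smul]
      rw [inj] at h1
      rw [Ne, inj] at h2
      simp [hg, h1, h2]
    · have hD : Alive M k v (z, i) := by
        refine ⟨hi, hz, fun x hx => ?_⟩
        by_contra hxv
        exact h2 ⟨⟨x, hx⟩, fun h => hxv ((inj _ _).1 (hx.symm.trans h))⟩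
      simp only [hΦ, if_pos hD]
  have step' : ∀ i < k, ∀ z, stepVal M v 0 (fun z i => Ψ (z, i)) i z ≤
      iterExt 5 2 (g' i) M z + ((k : ℝ) - i - 1) * 5^M := by
    intro i hi z
    have hi' : (0 : ℝ) ≤ (k : ℝ) - i - 1 := by
      have : ((i + 1 : ℕ) : ℝ) ≤ k := by exact_mod_cast hi
      push_cast at this; linarith
    have h5 : (0 : ℝ) ≤ 5^M := by positivity
    have hnn : 0 ≤ iterExt 5 2 (g' i) M z + ((k : ℝ) - i - 1) * 5^M :=
      add_nonneg (iterExt_nonneg (by norm_num) (by norm_num) (hg'0 i) M z) (mul_nonneg hi' h5)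
    simp only [stepVal]
    split_ifs with h1 h2
    · subst h1
      simp only [hΨ]
      split_ifs
      · rw [iterExt_pow_smul, iterExt_pow_smul]
        simp only [hg', if_true, hne i hi, if_false]
        push_cast
        nlinarith
      · exact hnn
    · exact hnn
    · simp only [hΨ]
      split_ifs
      · exact le_rfl
      · exact hnn
  have key : HasSum (fun n => (P ^ n) d ((2:ℤ)^M • v 0, 0)) (Φ ((2:ℤ)^M • v 0, 0)) := by
    refine hasSum_pow_of_harmonic P (Ψ := Ψ) (A := A) (C := 4) ?_ ?_ ?_ ?_ ?_ ?_ ?_ ?_ _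
    · intro f hf s
      simp only [hP, stepOp_apply, Pi.zero_apply]
      split_ifs
      · refine mul_nonneg (by norm_num) (Finset.sum_nonneg fun z _ => ?_)
        simp only [stepVal]
        split_ifs
        exacts [hf _, le_rfl, hf _]
      · exact le_rfl
    · intro s; simp only [hd, Pi.zero_apply]; split_ifs <;> norm_num
    · intro s; simp only [hA, Pi.zero_apply]; split_ifs <;> norm_num
    · funext s
      simp only [hP, stepOp_apply, Pi.add_apply]
      split_ifs with h
      · rw [Finset.sum_congr rfl fun z hz => step s.2 h.1 z (isVert_of_mem_nbr hz),
          ← Finset.mul_sum, laplacian_iterExt (δ := 0) (by norm_num) (by norm_num) _ M h.2.1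
            fun x hx => by rw [h.2.2 x hx]; exact lap s.2 h.1]
        have h' : ¬ IsDone M k v s := fun h' => not_alive s h' h
        simp only [hΦ, hd, if_pos h, if_neg h']
        ring
      · simp only [hΦ, if_neg h, add_zero]
    · intro s
      simp only [hΦ, hd, Pi.zero_apply]
      split_ifs
      · exact mul_nonneg (by positivity) (iterExt_le (hg0 s.2) M s.1).1
      · norm_num
      · exact le_rfl
    · intro s
      simp only [Pi.smul_apply, Pi.add_apply, smul_eq_mul]
      by_cases h : Alive M k v s
      · have h' : ¬ IsDone M k v s := fun h' => not_alive s h' h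
        simp only [hΦ, hA, hd, if_pos h, if_neg h']
        have h1 := iterExt_le (hg0 s.2) M s.1
        have h2 : (1/4 : ℝ)^(k - s.2) ≤ 1 := pow_le_one₀ (by norm_num) (by norm_num)
        nlinarith
      · simp only [hΦ, hA, hd, if_neg h]
        split_ifs <;> norm_num
    · intro s
      simp only [hΨ, Pi.zero_apply]
      split_ifs with h
      · have : ((s.2 + 1 : ℕ) : ℝ) ≤ k := by exact_mod_cast h.1
        push_cast at this
        exact add_nonneg (iterExt_nonneg (by norm_num) (by norm_num) (hg'0 s.2) M s.1)
          (mul_nonneg (by linarith) (by positivity))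
      · exact le_rfl
    · intro s
      simp only [hP, stepOp_apply, Pi.add_apply]
      by_cases h : Alive M k v s
      · have h1 := Finset.sum_le_sum fun z (_ : z ∈ nbr s.1) => step' s.2 h.1 z
        rw [Finset.sum_add_distrib, Finset.sum_const, nsmul_eq_mul, card_nbr h.2.1,
          laplacian_iterExt (δ := -4) (by norm_num) (by norm_num) _ M h.2.1
            fun x hx => by rw [h.2.2 x hx]; exact lap' s.2 h.1] at h1
        simp only [hA, if_pos h]
        have h2 : Ψ s = iterExt 5 2 (g' s.2) M s.1 + ((k : ℝ) - s.2 - 1) * 5^M := by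
          simp only [hΨ, if_pos h]
        rw [h2]
        linarith
      · simp only [hA, hΨ, if_neg h, add_zero, le_refl]
  simp only [hP, hd, stepOp_pow_done] at key
  have hD := alive_vert 0 hk ((isVert_pow_smul M _).2 (hv 0 hk).1)
  have e : Φ ((2:ℤ)^M • v 0, 0) = (1/4 : ℝ)^k := by
    simp only [hΦ, if_pos hD, iterExt_pow_smul, hg, if_true]
    simp
  rwa [e] at key

/-- The sequence `p` describes a walk with `n` steps from a state of index `i` to the final state,
visiting the vertices `v_{i+1}, …, v_k` of the coarse graph in this order. -/
def Follows (p : ℕ → ℤ × ℤ) (i n : ℕ) : Prop :=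
  i ≤ k ∧ p n = (2:ℤ)^M • v k ∧ (∀ j, n ≤ j → p j = p n) ∧
  (∀ j < n, IsVert (p j) ∧ p (j + 1) ∈ nbr (p j)) ∧
  ∃ t : ℕ → ℕ, t i = 0 ∧ t k = n ∧ ∀ i', i ≤ i' → i' < k →
    t i' < t (i' + 1) ∧ p (t (i' + 1)) = (2:ℤ)^M • v (i' + 1) ∧
    ∀ j, t i' ≤ j → j < t (i' + 1) → ∀ x, p j = (2:ℤ)^M • x → x = v i'

variable {M k v}

lemma Follows.cons {q : ℕ → ℤ × ℤ} {z : ℤ × ℤ} {i i₁ n : ℕ} (h : Follows M k v q i₁ n)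
    (hz : Alive M k v (z, i)) (hq : q 0 ∈ nbr z)
    (hi : i₁ = i ∨ i₁ = i + 1 ∧ q 0 = (2:ℤ)^M • v (i + 1)) :
    Follows M k v (consSeq z q) i (n + 1) := by
  obtain ⟨-, hend, hfr, hstep, t, ht0, htk, ht⟩ := h
  obtain ⟨hik, hvert, hx⟩ := hz
  dsimp only at hik hvert hx
  refine ⟨hik.le, hend, ?_, ?_, fun a => if a = i then 0 else t a + 1, by simp,
    by simp [hik.ne', htk], ?_⟩
  · intro j hj
    obtain ⟨j, rfl⟩ : ∃ j', j = j' + 1 := ⟨j - 1, by omega⟩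
    exact hfr j (by omega)
  · rintro (_ | j) hj
    · exact ⟨hvert, hq⟩
    · exact hstep j (by omega)
  · intro i' hi' hi'k
    rcases eq_or_lt_of_le hi' with rfl | hlt
    · simp only [if_true, Nat.succ_ne_self, if_false]
      rcases hi with rfl | ⟨rfl, hq0⟩
      · obtain ⟨-, h2, h3⟩ := ht _ le_rfl hi'k
        refine ⟨by omega, h2, ?_⟩
        rintro (_ | j) - hj x hxj
        · exact hx x hxj
        · exact h3 j (by omega) (by omega) x hxj
      · rw [ht0]
        refine ⟨by omega, hq0, ?_⟩
        intro j _ hj x hxj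
        obtain rfl : j = 0 := by omega
        exact hx x hxj
    · have e1 : i' ≠ i := by omega
      have e2 : i' + 1 ≠ i := by omega
      simp only [e1, e2, if_false]
      obtain ⟨h1, h2, h3⟩ := ht i' (by omega) hi'k
      refine ⟨by omega, h2, ?_⟩
      rintro (_ | j) hj hj' x hxj
      · omega
      · exact h3 j (by omega) (by omega) x hxj

lemma follows_of_mem_walks {n : ℕ} {z : ℤ × ℤ} {i : ℕ} {p : ℕ → ℤ × ℤ}
    (h : p ∈ walks M k v n z i) : Follows M k v p i n := by
  induction n generalizing z i p with
  | zero =>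
    simp only [walks] at h
    split_ifs at h with hd
    · rw [Finset.mem_singleton] at h
      subst h
      obtain ⟨rfl, hz⟩ := hd
      exact ⟨le_rfl, hz, fun _ _ => rfl, fun j hj => by omega, fun _ => 0, rfl, rfl,
        fun i' h1 h2 => by omega⟩
    · simp at h
  | succ n ih =>
    simp only [walks] at h
    split_ifs at h with ha
    · obtain ⟨z', hz', h⟩ := Finset.mem_biUnion.1 h
      obtain ⟨q, hq, rfl⟩ := Finset.mem_image.1 h
      obtain rfl := apply_zero_of_mem_stepVal hq
      simp only [stepVal] at hq
      split_ifs at hq with h1 h2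
      · exact (ih hq).cons ha hz' (Or.inr ⟨rfl, h1⟩)
      · simp at hq
      · exact (ih hq).cons ha hz' (Or.inl rfl)
    · simp at h

lemma Follows.tail {p : ℕ → ℤ × ℤ} {i i₁ n : ℕ} {t : ℕ → ℕ}
    (hend : p (n + 1) = (2:ℤ)^M • v k) (hfr : ∀ j, n + 1 ≤ j → p j = p (n + 1))
    (hstep : ∀ j < n + 1, IsVert (p j) ∧ p (j + 1) ∈ nbr (p j)) (htk : t k = n + 1)
    (ht : ∀ i', i ≤ i' → i' < k →
      t i' < t (i' + 1) ∧ p (t (i' + 1)) = (2:ℤ)^M • v (i' + 1) ∧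
      ∀ j, t i' ≤ j → j < t (i' + 1) → ∀ x, p j = (2:ℤ)^M • x → x = v i')
    (hik : i₁ ≤ k) (hi : i ≤ i₁) (ht1 : t i₁ - 1 = 0) (hlt : 1 < t (i₁ + 1) ∨ i < i₁) :
    Follows M k v (fun j => p (j + 1)) i₁ n := by
  refine ⟨hik, hend, fun j hj => hfr _ (by omega), fun j hj => hstep _ (by omega),
    fun a => t a - 1, ht1, by simp [htk], ?_⟩
  intro i' h1 h2
  obtain ⟨h3, h4, h5⟩ := ht i' (by omega) h2
  have h6 : 1 < t (i' + 1) := by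
    by_cases h : i' = i
    · obtain rfl : i₁ = i' := by omega
      omega
    · obtain ⟨c, rfl⟩ : ∃ c, i' = c + 1 := ⟨i' - 1, by omega⟩
      have := (ht c (by omega) (by omega)).1
      omega
  dsimp only
  refine ⟨by omega, ?_, fun j hj hj' x hx => h5 (j + 1) (by omega) (by omega) x hx⟩
  rw [Nat.sub_add_cancel h6.le]
  exact h4

lemma mem_walks_of_follows (hv : ∀ i < k, v (i + 1) ≠ v i) {n : ℕ} {i : ℕ} {p : ℕ → ℤ × ℤ}
    (h : Follows M k v p i n) : p ∈ walks M k v n (p 0) i := by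
  induction n generalizing i p with
  | zero =>
    obtain ⟨hik, hend, hfr, hstep, t, ht0, htk, ht⟩ := h
    have hik' : i = k := by
      by_contra hne
      obtain ⟨c, rfl⟩ : ∃ c, k = c + 1 := ⟨k - 1, by omega⟩
      have := (ht c (by omega) (by omega)).1
      omega
    simp only [walks]
    rw [if_pos ⟨hik', hend⟩, Finset.mem_singleton]
    exact funext fun j => hfr j (Nat.zero_le j)
  | succ n ih =>
    obtain ⟨hik, hend, hfr, hstep, t, ht0, htk, ht⟩ := h
    have hik' : i < k := lt_of_le_of_ne hik (by rintro rfl; omega)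
    obtain ⟨h1, h2, h3⟩ := ht i le_rfl hik'
    have ha : Alive M k v (p 0, i) :=
      ⟨hik', (hstep 0 (by omega)).1, h3 0 (by omega) (by omega)⟩
    simp only [walks]
    rw [if_pos ha, Finset.mem_biUnion]
    refine ⟨p 1, (hstep 0 (by omega)).2, Finset.mem_image.2 ⟨fun j => p (j + 1), ?_, ?_⟩⟩
    · rcases Nat.lt_or_ge 1 (t (i + 1)) with hlt | hle
      · have h4 := h3 1 (by omega) hlt
        have h5 : p 1 ≠ (2:ℤ)^M • v (i + 1) := fun h => hv i hik' (h4 _ h)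
        have h6 : ¬ ((∃ x, p 1 = (2:ℤ)^M • x) ∧ p 1 ≠ (2:ℤ)^M • v i) := by
          rintro ⟨⟨x, hx⟩, h⟩
          exact h (by rw [hx, h4 x hx])
        rw [stepVal, if_neg h5, if_neg h6]
        exact ih (Follows.tail hend hfr hstep htk ht hik le_rfl (by omega) (Or.inl hlt))
      · have h4 : t (i + 1) = 1 := by omega
        rw [h4] at h2
        rw [stepVal, if_pos h2]
        exact ih (Follows.tail hend hfr hstep htk ht hik' (by omega) (by omega)
          (Or.inr (by omega)))
    · funext j
      cases j <;> rfl

end Follow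

/-! ### The embedding of the lattice in the plane -/

/-- The point of the plane with given coordinates in the basis `(a_0, b_0)`. -/
def toPt (z : ℤ × ℤ) : Pt := ((z.1 : ℝ) * (1/2) + z.2, z.1 * (Real.sqrt 3 / 2))

lemma toPt_add (x y : ℤ × ℤ) : toPt (x + y) = toPt x + toPt y := by
  simp only [toPt, Prod.fst_add, Prod.snd_add, Int.cast_add, Prod.mk_add_mk]
  congr 1 <;> ring

lemma toPt_pow_smul (M : ℕ) (x : ℤ × ℤ) : toPt ((2:ℤ)^M • x) = (2:ℝ)^M • toPt x := by
  simp only [toPt, Prod.smul_fst, Prod.smul_snd, smul_eq_mul, Int.cast_mul, Int.cast_pow,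
    Int.cast_ofNat, Prod.smul_mk]
  congr 1 <;> ring

lemma toPt_injective : Function.Injective toPt := by
  rintro ⟨a, b⟩ ⟨c, d⟩ h
  simp only [toPt, Prod.mk.injEq] at h
  have h3 : Real.sqrt 3 / 2 ≠ 0 := by positivity
  have h1 := mul_right_cancel₀ h3 h.2
  have h2 : (b : ℝ) = d := by linarith [h.1]
  exact Prod.ext (by exact_mod_cast h1) (by exact_mod_cast h2)

lemma toPt_zero : toPt 0 = ptO := by simp [toPt, ptO]

lemma toPt_A (N : ℕ) : toPt ((2:ℤ)^N, 0) = ptA N := by simp [toPt, ptA]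

lemma toPt_B (N : ℕ) : toPt (0, (2:ℤ)^N) = ptB N := by simp [toPt, ptB]

lemma mem_preVerts {N : ℕ} {p : Pt} :
    p ∈ preVerts N ↔ ∃ t ∈ bases N, ∃ d ∈ corners, toPt (t + d) = p := by
  induction N generalizing p with
  | zero =>
    have hA := toPt_A 0
    have hB := toPt_B 0
    have hO := toPt_zero
    simp only [pow_zero] at hA hB
    simp only [preVerts, bases, ← hA, ← hB, ← hO]
    simp [eq_comm, ← Prod.mk_zero_zero]
  | succ N ih =>
    simp only [preVerts, Set.mem_union, Set.mem_image, ih]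
    constructor
    · rintro ((⟨t, ht, d, hd, rfl⟩ | ⟨_, ⟨t, ht, d, hd, rfl⟩, rfl⟩) |
        ⟨_, ⟨t, ht, d, hd, rfl⟩, rfl⟩)
      · exact ⟨t, Or.inl ht, d, hd, rfl⟩
      · refine ⟨t + (2^N, 0), Or.inr (Or.inl (by simpa using ht)), d, hd, ?_⟩
        rw [← toPt_A, ← toPt_add, add_right_comm]
      · refine ⟨t + (0, 2^N), Or.inr (Or.inr (by simpa using ht)), d, hd, ?_⟩
        rw [← toPt_B, ← toPt_add, add_right_comm]
    · rintro ⟨t, ht | ht | ht, d, hd, rfl⟩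
      · exact Or.inl (Or.inl ⟨t, ht, d, hd, rfl⟩)
      · refine Or.inl (Or.inr ⟨_, ⟨_, ht, d, hd, rfl⟩, ?_⟩)
        rw [← toPt_A, ← toPt_add, add_right_comm, sub_add_cancel]
      · refine Or.inr ⟨_, ⟨_, ht, d, hd, rfl⟩, ?_⟩
        rw [← toPt_B, ← toPt_add, add_right_comm, sub_add_cancel]

lemma mem_preEdges {N : ℕ} {e : Pt × Pt} :
    e ∈ preEdges N ↔ ∃ t ∈ bases N, ∃ d ∈ corners, ∃ d' ∈ corners, d ≠ d' ∧
      (toPt (t + d), toPt (t + d')) = e := by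
  induction N generalizing e with
  | zero =>
    have hA := toPt_A 0
    have hB := toPt_B 0
    have hO := toPt_zero
    simp only [pow_zero] at hA hB
    simp only [preEdges, bases, ← hA, ← hB, ← hO]
    simp [eq_comm, ← Prod.mk_zero_zero, or_assoc]
    tauto
  | succ N ih =>
    simp only [preEdges, Set.mem_union, Set.mem_image, ih]
    constructor
    · rintro ((⟨t, ht, d, hd, d', hd', hne, rfl⟩ | ⟨_, ⟨t, ht, d, hd, d', hd', hne, rfl⟩, rfl⟩) |
        ⟨_, ⟨t, ht, d, hd, d', hd', hne, rfl⟩, rfl⟩)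
      · exact ⟨t, Or.inl ht, d, hd, d', hd', hne, rfl⟩
      · refine ⟨t + (2^N, 0), Or.inr (Or.inl (by simpa using ht)), d, hd, d', hd', hne, ?_⟩
        simp only [← toPt_A, ← toPt_add, add_right_comm]
      · refine ⟨t + (0, 2^N), Or.inr (Or.inr (by simpa using ht)), d, hd, d', hd', hne, ?_⟩
        simp only [← toPt_B, ← toPt_add, add_right_comm]
    · rintro ⟨t, ht | ht | ht, d, hd, d', hd', hne, rfl⟩
      · exact Or.inl (Or.inl ⟨t, ht, d, hd, d', hd', hne, rfl⟩)
      · refine Or.inl (Or.inr ⟨_, ⟨_, ht, d, hd, d', hd', hne, rfl⟩, ?_⟩)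
        simp only [← toPt_A, ← toPt_add, add_right_comm _ _ ((2:ℤ)^N, (0:ℤ)), sub_add_cancel]
      · refine Or.inr ⟨_, ⟨_, ht, d, hd, d', hd', hne, rfl⟩, ?_⟩
        simp only [← toPt_B, ← toPt_add, add_right_comm _ _ ((0:ℤ), (2:ℤ)^N), sub_add_cancel]

/-- Reflection in the `y`-axis, acting on the corners of the triangles. -/
def reflCorner (d : ℤ × ℤ) : ℤ × ℤ := (d.1, 1 - d.1 - d.2)

lemma reflY_toPt (t d : ℤ × ℤ) : reflY (toPt (t + d)) = toPt (reflBase t + reflCorner d) := by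
  simp only [reflY, toPt, reflBase, reflCorner, Prod.fst_add, Prod.snd_add, Int.cast_add,
    Int.cast_sub, Int.cast_neg, Int.cast_one]
  congr 1
  ring

lemma reflCorner_mem {d : ℤ × ℤ} (hd : d ∈ corners) : reflCorner d ∈ corners := by
  simp only [Finset.mem_insert, Finset.mem_singleton] at hd ⊢
  rcases hd with rfl | rfl | rfl <;> simp [reflCorner]

lemma reflBase_reflBase (t : ℤ × ℤ) : reflBase (reflBase t) = t := by
  simp [reflBase]

lemma reflCorner_reflCorner (t : ℤ × ℤ) : reflCorner (reflCorner t) = t := by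
  simp [reflCorner]

lemma mem_G0 {p : Pt} : p ∈ G0 ↔ ∃ z, IsVert z ∧ toPt z = p := by
  simp only [G0, Set.mem_iUnion, Set.mem_union, Set.mem_image, mem_preVerts]
  constructor
  · rintro ⟨N, ⟨t, ht, d, hd, rfl⟩ | ⟨_, ⟨t, ht, d, hd, rfl⟩, rfl⟩⟩
    · exact ⟨_, isVert_iff.2 ⟨t, ⟨N, Or.inl ht⟩, d, hd, rfl⟩, rfl⟩
    · refine ⟨_, isVert_iff.2 ⟨reflBase t, ⟨N, Or.inr ?_⟩, _, reflCorner_mem hd, rfl⟩,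
        (reflY_toPt t d).symm⟩
      rwa [reflBase_reflBase]
  · rintro ⟨z, hz, rfl⟩
    obtain ⟨t, ⟨N, ht | ht⟩, d, hd, rfl⟩ := isVert_iff.1 hz
    · exact ⟨N, Or.inl ⟨t, ht, d, hd, rfl⟩⟩
    · refine ⟨N, Or.inr ⟨_, ⟨_, ht, _, reflCorner_mem hd, rfl⟩, ?_⟩⟩
      rw [reflY_toPt, reflBase_reflBase, reflCorner_reflCorner]

lemma mem_E0 {z z' : ℤ × ℤ} : (toPt z, toPt z') ∈ E0 ↔ z' ∈ nbr z := by
  rw [mem_nbr]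
  simp only [E0, Set.mem_iUnion, Set.mem_union, Set.mem_image, mem_preEdges]
  constructor
  · rintro ⟨N, ⟨t, ht, d, hd, d', hd', hne, h⟩ | ⟨_, ⟨t, ht, d, hd, d', hd', hne, rfl⟩, h⟩⟩
    · rw [Prod.mk.injEq, toPt_injective.eq_iff, toPt_injective.eq_iff] at h
      exact ⟨t, ⟨N, Or.inl ht⟩, d, hd, d', hd', hne, h.1.symm, h.2.symm⟩
    · rw [Prod.mk.injEq, reflY_toPt, reflY_toPt, toPt_injective.eq_iff,
        toPt_injective.eq_iff] at h
      refine ⟨reflBase t, ⟨N, Or.inr ?_⟩, _, reflCorner_mem hd, _, reflCorner_mem hd', ?_,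
        h.1.symm, h.2.symm⟩
      · rwa [reflBase_reflBase]
      · intro h'
        apply hne
        rw [← reflCorner_reflCorner d, h', reflCorner_reflCorner]
  · rintro ⟨t, ⟨N, ht | ht⟩, d, hd, d', hd', hne, rfl, rfl⟩
    · exact ⟨N, Or.inl ⟨t, ht, d, hd, d', hd', hne, rfl⟩⟩
    · refine ⟨N, Or.inr ⟨_, ⟨_, ht, _, reflCorner_mem hd, _, reflCorner_mem hd', ?_, rfl⟩, ?_⟩⟩
      · intro h'
        apply hne
        rw [← reflCorner_reflCorner d, h', reflCorner_reflCorner]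
      · simp only [reflY_toPt, reflBase_reflBase, reflCorner_reflCorner]

lemma mem_G {M : ℕ} {p : Pt} : p ∈ G M ↔ ∃ x, IsVert x ∧ toPt ((2:ℤ)^M • x) = p := by
  simp only [G, Set.mem_image, mem_G0]
  constructor
  · rintro ⟨_, ⟨x, hx, rfl⟩, rfl⟩
    exact ⟨x, hx, toPt_pow_smul M x⟩
  · rintro ⟨x, hx, rfl⟩
    exact ⟨_, ⟨x, hx, rfl⟩, (toPt_pow_smul M x).symm⟩

lemma toPt_mem_G {M : ℕ} {z : ℤ × ℤ} (hz : IsVert z) :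
    toPt z ∈ G M ↔ ∃ x, z = (2:ℤ)^M • x := by
  rw [mem_G]
  constructor
  · rintro ⟨x, -, h⟩
    exact ⟨x, (toPt_injective h).symm⟩
  · rintro ⟨x, rfl⟩
    exact ⟨x, (isVert_pow_smul M x).1 hz, rfl⟩

/-! ### Hitting times and coarse graining -/

/-- The times `t_0 < t_1 < … < t_k` are the successive hitting times of `G_M` by the path `w`,
which starts in `G_M` and ends at time `t_k`. -/
structure IsHitTimes (M : ℕ) (w : Path) (k : ℕ) (t : ℕ → ℕ) : Prop where
  zero : t 0 = 0
  last : t k = w.len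
  lt : ∀ i < k, t i < t (i + 1)
  mem : ∀ i ≤ k, w.X (t i) ∈ G M
  ne : ∀ i < k, w.X (t (i + 1)) ≠ w.X (t i)
  between : ∀ i < k, ∀ j, t i ≤ j → j < t (i + 1) → w.X j ∈ G M → w.X j = w.X (t i)

lemma hitT_zero {M : ℕ} {w : Path} (h : w.X 0 ∈ G M) : hitT M w 0 = 0 :=
  Nat.sInf_eq_zero.2 (Or.inl h)

lemma hitT_succ_eq {M : ℕ} {w : Path} {i t : ℕ} (h : hitT M w i < t) (ht : w.X t ∈ G M)
    (hne : w.X t ≠ w.X (hitT M w i))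
    (hlt : ∀ j, hitT M w i < j → j < t → w.X j ∈ G M → w.X j = w.X (hitT M w i)) :
    hitT M w (i + 1) = t := by
  refine le_antisymm (Nat.sInf_le ⟨h, ht, hne⟩) (le_csInf ⟨t, h, ht, hne⟩ ?_)
  rintro j ⟨h1, h2, h3⟩
  by_contra hj
  exact h3 (hlt j h1 (not_le.1 hj) h2)

namespace IsHitTimes

variable {M : ℕ} {w : Path} {k : ℕ} {t : ℕ → ℕ}

lemma mono (h : IsHitTimes M w k t) {i i' : ℕ} (hi : i ≤ i') (hk : i' ≤ k) : t i ≤ t i' := by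
  induction i', hi using Nat.le_induction with
  | base => exact le_rfl
  | succ n _ ih => exact (ih (by omega)).trans (h.lt n (by omega)).le

lemma strictMono (h : IsHitTimes M w k t) {i i' : ℕ} (hi : i < i') (hk : i' ≤ k) : t i < t i' :=
  (h.lt i (by omega)).trans_le (h.mono hi hk)

lemma exists_between (h : IsHitTimes M w k t) {j : ℕ} (hj : j < w.len) :
    ∃ i < k, t i ≤ j ∧ j < t (i + 1) := by
  have H : ∀ n ≤ k, j < t n → ∃ i < n, t i ≤ j ∧ j < t (i + 1) := by
    intro n
    induction n with
    | zero => intro _ h0; rw [h.zero] at h0; omega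
    | succ n ih =>
      intro hn hjn
      by_cases hjn' : t n ≤ j
      · exact ⟨n, n.lt_succ_self, hjn', hjn⟩
      · obtain ⟨i, hi, h'⟩ := ih (by omega) (not_le.1 hjn')
        exact ⟨i, by omega, h'⟩
  exact H k le_rfl (h.last ▸ hj)

lemma hitT_eq (h : IsHitTimes M w k t) {i : ℕ} (hi : i ≤ k) : hitT M w i = t i := by
  induction i with
  | zero =>
    rw [h.zero]
    exact hitT_zero (by simpa only [h.zero] using h.mem 0 hi)
  | succ i ih =>
    have e := ih (by omega)
    apply hitT_succ_eq
    · rw [e]; exact h.lt i hi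
    · exact h.mem _ hi
    · rw [e]; exact h.ne i hi
    · rw [e]; exact fun j h1 h2 => h.between i hi j h1.le h2

lemma coarseLen_eq (h : IsHitTimes M w k t) : coarseLen M w = k := by
  have hk : hitT M w k = w.len := (h.hitT_eq le_rfl).trans h.last
  refine le_antisymm (Nat.sInf_le hk) (le_csInf ⟨k, hk⟩ fun i hi => ?_)
  by_contra hik
  rw [not_le] at hik
  have := h.strictMono hik le_rfl
  rw [← h.hitT_eq hik.le, h.last] at this
  exact this.ne hi

lemma scalePath_coarse_eq (h : IsHitTimes M w k t) {u : Path} (hk : u.len = k)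
    (hu : ∀ i ≤ k, w.X (t i) = (2:ℝ)^M • u.X i) (hfr : ∀ i, u.len ≤ i → u.X i = u.X u.len) :
    scalePath ((2:ℝ)^M)⁻¹ (coarse M w) = u := by
  obtain ⟨X, len⟩ := u
  dsimp only at hk hu hfr
  subst hk
  simp only [scalePath, coarse, h.coarseLen_eq, Path.mk.injEq, and_true]
  funext i
  rw [h.hitT_eq (min_le_right _ _), hu _ (min_le_right _ _),
    inv_smul_smul₀ (pow_ne_zero _ two_ne_zero)]
  rcases le_total i len with hi | hi
  · rw [min_eq_left hi]
  · rw [min_eq_right hi, hfr i hi]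

end IsHitTimes

/-- If a path starts in `G_M` and ends at its first visit of some vertex of `G_M`, its hitting
times of `G_M` are defined up to its end. -/
lemma isHitTimes_hitT {M : ℕ} {w : Path} (h0 : w.X 0 ∈ G M) (hlast : w.X w.len ∈ G M)
    (hne : ∀ j < w.len, w.X j ≠ w.X w.len) :
    IsHitTimes M w (coarseLen M w) (hitT M w) := by
  have step : ∀ i, hitT M w i < w.len →
      hitT M w (i + 1) ≤ w.len ∧ hitT M w i < hitT M w (i + 1) ∧ w.X (hitT M w (i + 1)) ∈ G M ∧
        w.X (hitT M w (i + 1)) ≠ w.X (hitT M w i) := by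
    intro i hi
    have hmem : hitT M w i < w.len ∧ w.X w.len ∈ G M ∧ w.X w.len ≠ w.X (hitT M w i) :=
      ⟨hi, hlast, (hne _ hi).symm⟩
    exact ⟨Nat.sInf_le hmem, Nat.sInf_mem (s := {j | hitT M w i < j ∧ w.X j ∈ G M ∧
      w.X j ≠ w.X (hitT M w i)}) ⟨_, hmem⟩⟩
  have hle : ∀ i, (∀ i' < i, hitT M w i' ≠ w.len) → i ≤ hitT M w i ∧ hitT M w i ≤ w.len := by
    intro i
    induction i with
    | zero => intro _; rw [hitT_zero h0]; omega
    | succ i ih =>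
      intro h
      have h1 := ih fun i' hi' => h i' (by omega)
      have h2 := step i (lt_of_le_of_ne h1.2 (h i (by omega)))
      omega
  have hex : {i | hitT M w i = w.len}.Nonempty := by
    by_contra hemp
    rw [Set.not_nonempty_iff_eq_empty] at hemp
    have h : ∀ i, hitT M w i ≠ w.len := fun i hi => by
      have : i ∈ {i | hitT M w i = w.len} := hi
      rw [hemp] at this
      exact this
    have := hle (w.len + 1) fun i _ => h i
    omega
  have hbefore : ∀ i < coarseLen M w, hitT M w i ≠ w.len := fun i hi h =>
    Nat.notMem_of_lt_sInf (s := {i | hitT M w i = w.len}) hi h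
  have hlt : ∀ i < coarseLen M w, hitT M w i < w.len := fun i hi =>
    lt_of_le_of_ne (hle i fun i' hi' => hbefore i' (hi'.trans hi)).2 (hbefore i hi)
  refine ⟨hitT_zero h0, Nat.sInf_mem hex, fun i hi => (step i (hlt i hi)).2.1, ?_,
    fun i hi => (step i (hlt i hi)).2.2.2, ?_⟩
  · rintro (_ | i) hi
    · rwa [hitT_zero h0]
    · exact (step i (hlt i (by omega))).2.2.1
  · intro i hi j h1 h2 hj
    rcases h1.eq_or_lt with rfl | h1
    · rfl
    · by_contra h3
      exact Nat.notMem_of_lt_sInf h2 ⟨h1, hj, h3⟩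

/-! ### The two families of paths -/

lemma ptO_mem_G (N : ℕ) : ptO ∈ G N :=
  mem_G.2 ⟨0, Or.inl ⟨0, Or.inl (by simp [bases])⟩, by rw [smul_zero, toPt_zero]⟩

lemma smul_ptA (M K : ℕ) : (2:ℝ)^M • ptA K = ptA (M + K) := by
  simp only [ptA, Prod.smul_mk, smul_eq_mul, pow_add]
  congr 1 <;> ring

lemma smul_ptB (M K : ℕ) : (2:ℝ)^M • ptB K = ptB (M + K) := by
  simp only [ptB, Prod.smul_mk, smul_eq_mul, pow_add, mul_zero]

lemma smul_ptO (M : ℕ) : (2:ℝ)^M • ptO = ptO := by simp [ptO]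

lemma ptA_mem_G (N : ℕ) : ptA N ∈ G N := by
  refine ⟨ptA 0, Set.mem_iUnion.2 ⟨0, Or.inl (by simp [preVerts])⟩, smul_ptA N 0⟩

lemma ptB_mem_G (N : ℕ) : ptB N ∈ G N := by
  refine ⟨ptB 0, Set.mem_iUnion.2 ⟨0, Or.inl (by simp [preVerts])⟩, smul_ptB N 0⟩

lemma ptA_ne_ptO (N : ℕ) : ptA N ≠ ptO := by simp [ptA, ptO]

lemma ptB_ne_ptO (N : ℕ) : ptB N ≠ ptO := by simp [ptB, ptO]

lemma ptA_ne_ptB (N : ℕ) : ptA N ≠ ptB N := by simp [ptA, ptB]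

lemma G_anti {M N : ℕ} (h : M ≤ N) : G N ⊆ G M := by
  obtain ⟨K, rfl⟩ := Nat.exists_eq_add_of_le h
  intro p hp
  obtain ⟨x, hx, rfl⟩ := mem_G.1 hp
  exact mem_G.2 ⟨(2:ℤ)^K • x, (isVert_pow_smul K x).2 hx, by rw [smul_smul, pow_add]⟩

lemma smul_mem_G {M K : ℕ} {p : Pt} : (2:ℝ)^M • p ∈ G (M + K) ↔ p ∈ G K := by
  simp only [G, Set.mem_image]
  refine exists_congr fun q => and_congr_right fun _ => ?_
  rw [pow_add, mul_smul]
  exact (smul_right_injective Pt (pow_ne_zero M two_ne_zero)).eq_iff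

lemma mem_WSet {N : ℕ} {w : Path} : w ∈ WSet N ↔ IsWalk w ∧ w.X w.len = ptA N ∧
    ∀ j < w.len, w.X j ∈ G N → w.X j = ptO := by
  refine and_congr_right fun hw => and_congr_right fun hA => ?_
  have hO : w.X 0 = ptO := hw.1
  have h0 : hitT N w 0 = 0 := hitT_zero (hO ▸ ptO_mem_G N)
  have hpos : 0 < w.len := Nat.pos_of_ne_zero fun h => ptA_ne_ptO N (by rw [← hA, h, hO])
  constructor
  · intro h j hj hjG
    by_contra hne
    rw [h] at hj
    refine Nat.notMem_of_lt_sInf hj ⟨?_, hjG, by rwa [h0, hO]⟩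
    rw [h0]
    exact Nat.pos_of_ne_zero fun h => hne (by rw [h, hO])
  · intro h
    refine (hitT_succ_eq ?_ ?_ ?_ ?_).symm
    · rwa [h0]
    · rw [hA]; exact ptA_mem_G N
    · rw [h0, hO, hA]; exact ptA_ne_ptO N
    · intro j _ hj hjG
      rw [h0, hO]; exact h j hj hjG

lemma mem_VSet {N : ℕ} {w : Path} : w ∈ VSet N ↔ IsWalk w ∧ w.X w.len = ptA N ∧
    ∃ T < w.len, w.X T = ptB N ∧ (∀ j < T, w.X j ∈ G N → w.X j = ptO) ∧
      ∀ j, T ≤ j → j < w.len → w.X j ∈ G N → w.X j = ptB N := by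
  constructor
  · rintro ⟨hw, hB, hA, h⟩
    have hO : w.X 0 = ptO := hw.1
    have h0 : hitT N w 0 = 0 := hitT_zero (hO ▸ ptO_mem_G N)
    have hpos : 0 < w.len := Nat.pos_of_ne_zero fun h => ptA_ne_ptO N (by rw [← hA, h, hO])
    rw [h] at hpos
    refine ⟨hw, hA, hitT N w 1, ?_, hB, ?_, ?_⟩
    · rw [h]
      exact (Nat.sInf_mem (Nat.nonempty_of_pos_sInf hpos)).1
    · intro j hj hjG
      by_contra hne
      refine Nat.notMem_of_lt_sInf hj ⟨?_, hjG, by rwa [h0, hO]⟩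
      rw [h0]
      exact Nat.pos_of_ne_zero fun h => hne (by rw [h, hO])
    · intro j hTj hj hjG
      rcases hTj.eq_or_lt with rfl | hTj
      · exact hB
      · by_contra hne
        rw [h] at hj
        exact Nat.notMem_of_lt_sInf hj ⟨hTj, hjG, by rwa [hB]⟩
  · rintro ⟨hw, hA, T, hT, hB, h1, h2⟩
    have hO : w.X 0 = ptO := hw.1
    have h0 : hitT N w 0 = 0 := hitT_zero (hO ▸ ptO_mem_G N)
    have hpos : 0 < T := Nat.pos_of_ne_zero fun h => ptB_ne_ptO N (by rw [← hB, h, hO])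
    have e1 : hitT N w 1 = T := by
      apply hitT_succ_eq
      · rwa [h0]
      · rw [hB]; exact ptB_mem_G N
      · rw [h0, hO, hB]; exact ptB_ne_ptO N
      · intro j _ hj hjG
        rw [h0, hO]; exact h1 j hj hjG
    refine ⟨hw, by rw [e1, hB], hA, (hitT_succ_eq ?_ ?_ ?_ ?_).symm⟩
    · rwa [e1]
    · rw [hA]; exact ptA_mem_G N
    · rw [e1, hA, hB]; exact ptA_ne_ptB N
    · intro j hj1 hj2 hjG
      rw [e1] at hj1
      rw [e1, hB]; exact h2 j hj1.le hj2 hjG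

/-! ### The law of the coarse-grained path -/

lemma isWalk_iff {w : Path} : IsWalk w ↔ ∃ p : ℕ → ℤ × ℤ, (w.X = fun i => toPt (p i)) ∧
    p 0 = 0 ∧ (∀ i ≤ w.len, IsVert (p i)) ∧ (∀ i < w.len, p (i + 1) ∈ nbr (p i)) ∧
    ∀ i, w.len ≤ i → p i = p w.len := by
  constructor
  · rintro ⟨h0, h1, h2, h3⟩
    have hG : ∀ i, w.X i ∈ G0 := fun i => by
      rcases le_total i w.len with hi | hi
      · exact h1 i hi
      · rw [h3 i hi]; exact h1 _ le_rfl
    choose p hp hpX using fun i => mem_G0.1 (hG i)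
    refine ⟨p, funext fun i => (hpX i).symm, toPt_injective ?_, fun i _ => hp i, fun i hi => ?_,
      fun i hi => toPt_injective ?_⟩
    · rw [hpX, h0, toPt_zero]
    · rw [← mem_E0, hpX, hpX]; exact h2 i hi
    · rw [hpX, hpX, h3 i hi]
  · rintro ⟨p, hX, h0, h1, h2, h3⟩
    simp only [IsWalk, hX]
    exact ⟨by rw [h0, toPt_zero], fun i hi => mem_G0.2 ⟨_, h1 i hi, rfl⟩,
      fun i hi => mem_E0.2 (h2 i hi), fun i hi => by rw [h3 i hi]⟩

/-- A walk of the fine graph has hitting times of `G_M` along the coarse path `v` if and only if it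
follows `v`. -/
lemma follows_iff {M k n : ℕ} {v p : ℕ → ℤ × ℤ} (hv0 : v 0 = 0)
    (hv : ∀ i ≤ k, IsVert (v i)) (hvn : ∀ i < k, v (i + 1) ∈ nbr (v i)) :
    (p 0 = 0 ∧ Follows M k v p 0 n) ↔ IsWalk ⟨fun i => toPt (p i), n⟩ ∧
      ∃ t, IsHitTimes M ⟨fun i => toPt (p i), n⟩ k t ∧
        ∀ i ≤ k, toPt (p (t i)) = (2:ℝ)^M • toPt (v i) := by
  constructor
  · rintro ⟨hp0, -, hend, hfr, hstep, t, ht0, htk, ht⟩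
    have hvert : ∀ i, IsVert (p i) := fun i => by
      rcases lt_or_ge i n with hi | hi
      · exact (hstep i hi).1
      · rw [hfr i hi, hend]; exact (isVert_pow_smul M _).2 (hv k le_rfl)
    have hpt : ∀ i ≤ k, p (t i) = (2:ℤ)^M • v i := by
      rintro (_ | i) hi
      · rw [ht0, hp0, hv0, smul_zero]
      · exact (ht i i.zero_le hi).2.1
    refine ⟨isWalk_iff.2 ⟨p, rfl, hp0, fun i _ => hvert i, fun i hi => (hstep i hi).2, hfr⟩,
      t, ⟨ht0, htk, fun i hi => (ht i i.zero_le hi).1, ?_, ?_, ?_⟩, ?_⟩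
    · intro i hi
      exact mem_G.2 ⟨v i, hv i hi, congrArg toPt (hpt i hi).symm⟩
    · intro i hi h
      have h' := toPt_injective h
      rw [hpt _ hi, hpt _ hi.le] at h'
      exact ne_of_mem_nbr (hvn i hi) (smul_pow_injective M h')
    · intro i hi j h1 h2 hj
      obtain ⟨x, hx⟩ := (toPt_mem_G (hvert j)).1 hj
      have := (ht i i.zero_le hi).2.2 j h1 h2 x hx
      dsimp only
      rw [hpt i hi.le, hx, this]
    · intro i hi
      rw [hpt i hi, toPt_pow_smul]
  · rintro ⟨hw, t, ht, hpt⟩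
    obtain ⟨p', hX, hp0, hvert, hnbr, hfr⟩ := isWalk_iff.1 hw
    obtain rfl : p = p' := funext fun i => toPt_injective (congrFun hX i)
    have hpt' : ∀ i ≤ k, p (t i) = (2:ℤ)^M • v i := fun i hi =>
      toPt_injective (by rw [hpt i hi, toPt_pow_smul])
    refine ⟨hp0, k.zero_le, ?_, hfr, fun j hj => ⟨hvert j hj.le, hnbr j hj⟩, t, ht.zero, ht.last,
      fun i _ hi => ⟨ht.lt i hi, hpt' _ hi, fun j h1 h2 x hx => ?_⟩⟩
    · rw [← hpt' k le_rfl, ht.last]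
    · have hjn : j ≤ n := h2.le.trans ((ht.mono hi le_rfl).trans_eq ht.last)
      have := ht.between i hi j h1 h2 ((toPt_mem_G (hvert j hjn)).2 ⟨x, hx⟩)
      have := toPt_injective this
      rw [hpt' i hi.le, hx] at this
      exact smul_pow_injective M this

/-- Let `S` be a set of walks which contains all walks with coarse path `u`. The total weight of
the walks in `S` with coarse path `u` is the weight of `u`. -/
lemma tsum_coarse_eq {M : ℕ} {u : Path} (hu : IsWalk u) (hk : 0 < u.len) (S : Set Path)
    (hS : ∀ w ∈ S, IsWalk w ∧ w.X w.len ∈ G M ∧ ∀ j < w.len, w.X j ≠ w.X w.len)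
    (hS' : ∀ w t, IsWalk w → IsHitTimes M w u.len t →
      (∀ i ≤ u.len, w.X (t i) = (2:ℝ)^M • u.X i) → w ∈ S) :
    ∑' w : {w : Path // w ∈ S ∧ scalePath (((2:ℝ)^M)⁻¹) (coarse M w) = u}, (1/4 : ℝ)^w.1.len =
      (1/4 : ℝ)^u.len := by
  obtain ⟨v, huX, hv0, hv, hvn, -⟩ := isWalk_iff.1 hu
  have hfr : ∀ i, u.len ≤ i → u.X i = u.X u.len := hu.2.2.2
  have hsum := hasSum_card_walks M u.len v hk fun i hi => ⟨hv i hi.le, hvn i hi⟩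
  rw [hv0, smul_zero] at hsum
  have key : ∀ (p : ℕ → ℤ × ℤ) (n : ℕ), p ∈ walks M u.len v n 0 0 ↔
      (⟨fun i => toPt (p i), n⟩ : Path) ∈ S ∧
        scalePath (((2:ℝ)^M)⁻¹) (coarse M ⟨fun i => toPt (p i), n⟩) = u := by
    intro p n
    trans p 0 = 0 ∧ Follows M u.len v p 0 n
    · constructor
      · exact fun h => ⟨apply_zero_of_mem_walks h, follows_of_mem_walks h⟩
      · rintro ⟨h0, h⟩
        have := mem_walks_of_follows (fun i hi => ne_of_mem_nbr (hvn i hi)) h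
        rwa [h0] at this
    rw [follows_iff hv0 hv hvn]
    have huX' : ∀ i, toPt (v i) = u.X i := fun i => by rw [huX]
    simp only [huX']
    constructor
    · rintro ⟨hw, t, ht, htu⟩
      exact ⟨hS' _ t hw ht htu, ht.scalePath_coarse_eq rfl htu hfr⟩
    · rintro ⟨hw, hc⟩
      obtain ⟨h1, h2, h3⟩ := hS _ hw
      have ht := isHitTimes_hitT (h1.1 ▸ ptO_mem_G M) h2 h3
      have hlen : coarseLen M ⟨fun i => toPt (p i), n⟩ = u.len := congrArg Path.len hc
      rw [hlen] at ht
      refine ⟨h1, _, ht, fun i hi => ?_⟩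
      rw [← hc]
      simp only [scalePath, coarse, hlen, min_eq_left hi]
      rw [smul_inv_smul₀ (pow_ne_zero _ two_ne_zero)]
  let e : (Σ n, walks M u.len v n 0 0) →
      {w : Path // w ∈ S ∧ scalePath (((2:ℝ)^M)⁻¹) (coarse M w) = u} :=
    fun x => ⟨⟨fun i => toPt (x.2.1 i), x.1⟩, (key _ _).1 x.2.2⟩
  have he : Function.Bijective e := by
    constructor
    · rintro ⟨n, p, hp⟩ ⟨n', p', hp'⟩ h
      simp only [e, Subtype.mk.injEq, Path.mk.injEq] at h
      obtain ⟨h, rfl⟩ := h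
      obtain rfl : p = p' := funext fun i => toPt_injective (congrFun h i)
      rfl
    · rintro ⟨⟨X, n⟩, hw⟩
      obtain ⟨p, hX, -⟩ := isWalk_iff.1 (hS _ hw.1).1
      dsimp only at hX
      subst hX
      exact ⟨⟨n, p, (key p n).2 hw⟩, rfl⟩
  rw [← (Equiv.ofBijective e he).tsum_eq]
  have hfib : ∀ n, HasSum (fun _ : walks M u.len v n 0 0 => (1/4 : ℝ)^n)
      ((walks M u.len v n 0 0).card * (1/4 : ℝ)^n) := fun n => by
    have h := hasSum_fintype fun _ : walks M u.len v n 0 0 => (1/4 : ℝ)^n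
    rwa [Finset.sum_const, Finset.card_univ, Fintype.card_coe, nsmul_eq_mul] at h
  refine (HasSum.sigma_of_hasSum hsum hfib ?_).tsum_eq
  refine (summable_sigma_of_nonneg fun x => by positivity).2 ⟨fun n => (hfib n).summable, ?_⟩
  exact hsum.summable.congr fun n => (hfib n).tsum_eq.symm

/-- The visits of `G_{M+K}` by a walk are visits of `G_K` by its coarse path. -/
lemma IsHitTimes.eq_smul_of_mem {M K : ℕ} {w u : Path} {t : ℕ → ℕ} (ht : IsHitTimes M w u.len t)
    (hu : ∀ i ≤ u.len, w.X (t i) = (2:ℝ)^M • u.X i) {j : ℕ} (hj : j < w.len)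
    (hjG : w.X j ∈ G (M + K)) :
    ∃ i < u.len, t i ≤ j ∧ j < t (i + 1) ∧ w.X j = (2:ℝ)^M • u.X i ∧ u.X i ∈ G K := by
  obtain ⟨i, hi, h1, h2⟩ := ht.exists_between hj
  have e := (ht.between i hi j h1 h2 (G_anti (Nat.le_add_right M K) hjG)).trans (hu i hi.le)
  exact ⟨i, hi, h1, h2, e, smul_mem_G.1 (e ▸ hjG)⟩

lemma tsum_PW_coarse {M K : ℕ} {u : Path} (hu : u ∈ WSet K) :
    ∑' w : {w : Path // w ∈ WSet (M + K) ∧ scalePath (((2:ℝ)^M)⁻¹) (coarse M w) = u}, PW w.1 =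
      PW u := by
  obtain ⟨hw, hA, hO⟩ := mem_WSet.1 hu
  have hpos : 0 < u.len := Nat.pos_of_ne_zero fun h => ptA_ne_ptO K (by rw [← hA, h, hw.1])
  simp only [PW]
  rw [tsum_mul_left, tsum_coarse_eq hw hpos]
  · intro w h
    obtain ⟨h1, h2, h3⟩ := mem_WSet.1 h
    rw [h2]
    refine ⟨h1, G_anti (Nat.le_add_right M K) (ptA_mem_G _), fun j hj h => ptA_ne_ptO (M + K) ?_⟩
    rw [← h, h3 j hj (h ▸ ptA_mem_G _)]
  · intro w t h ht htu
    refine mem_WSet.2 ⟨h, ?_, fun j hj hjG => ?_⟩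
    · rw [← ht.last, htu _ le_rfl, hA, smul_ptA]
    · obtain ⟨i, hi, -, -, e, hiG⟩ := ht.eq_smul_of_mem htu hj hjG
      rw [e, hO i hi hiG, smul_ptO]

lemma tsum_PV_coarse {M K : ℕ} {u : Path} (hu : u ∈ VSet K) :
    ∑' w : {w : Path // w ∈ VSet (M + K) ∧ scalePath (((2:ℝ)^M)⁻¹) (coarse M w) = u}, PV w.1 =
      PV u := by
  obtain ⟨hw, hA, s, hs, hB, hO, hB'⟩ := mem_VSet.1 hu
  simp only [PV]
  rw [tsum_mul_left, tsum_coarse_eq hw (by omega)]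
  · intro w h
    obtain ⟨h1, h2, T, -, -, h3, h4⟩ := mem_VSet.1 h
    rw [h2]
    refine ⟨h1, G_anti (Nat.le_add_right M K) (ptA_mem_G _), fun j hj h => ?_⟩
    have hjG := h ▸ ptA_mem_G (M + K)
    rcases lt_or_ge j T with hT | hT
    · exact ptA_ne_ptO (M + K) (by rw [← h, h3 j hT hjG])
    · exact ptA_ne_ptB (M + K) (by rw [← h, h4 j hT hj hjG])
  · intro w t h ht htu
    have hT : t s < w.len := ht.last ▸ ht.strictMono hs le_rfl
    refine mem_VSet.2 ⟨h, ?_, t s, hT, ?_, fun j hj hjG => ?_, fun j hj1 hj2 hjG => ?_⟩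
    · rw [← ht.last, htu _ le_rfl, hA, smul_ptA]
    · rw [htu s hs.le, hB, smul_ptB]
    · obtain ⟨i, hi, h1, -, e, hiG⟩ := ht.eq_smul_of_mem htu (hj.trans hT) hjG
      have his : i < s := by
        by_contra his
        have := ht.mono (not_lt.1 his) hi.le
        omega
      rw [e, hO i his hiG, smul_ptO]
    · obtain ⟨i, hi, -, h2, e, hiG⟩ := ht.eq_smul_of_mem htu hj2 hjG
      have his : s ≤ i := by
        by_contra his
        have := ht.mono (i := i + 1) (i' := s) (not_le.1 his) hs.le
        omega
      rw [e, hB' i his hi hiG, smul_ptB]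

/-- Proposition 2.1.  If `M ≤ N` then `2^{-M} Q_M X_N` has distribution
`P_{N-M}` and `2^{-M} Q_M X'_N` has distribution `P'_{N-M}`. -/
theorem statement1 (M N : ℕ) (hMN : M ≤ N) :
    (∀ u ∈ WSet (N - M),
      (∑' w : {w : Path // w ∈ WSet N ∧ scalePath (((2:ℝ)^M)⁻¹) (coarse M w) = u}, PW w.1)
        = PW u) ∧
    (∀ u ∈ VSet (N - M),
      (∑' w : {w : Path // w ∈ VSet N ∧ scalePath (((2:ℝ)^M)⁻¹) (coarse M w) = u}, PV w.1)
        = PV u) := by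
  obtain ⟨K, rfl⟩ := Nat.exists_eq_add_of_le hMN
  rw [Nat.add_sub_cancel_left]
  exact ⟨fun _ => tsum_PW_coarse, fun _ => tsum_PV_coarse⟩

end LERW
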